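/- arXiv:1906.10459 — 3 statements merged into one kernel-verified Lean document; each statement's English description precedes it below -/
import Mathlib

section
/- Let L be an even positive-definite lattice and K ⊆ L a nonzero sublattice such that K^∨ ⊆ L^∨ inside L ⊗ ℚ (that is, every x ∈ K ⊗ ℚ with (x,k) ∈ ℤ for all k ∈ K also satisfies (x,y) ∈ ℤ for all y ∈ L). Set L_0 = {v ∈ L : (v,k) = 0 for all k ∈ K}. Then L is the internal orthogonal direct sum of K and L_0, i.e. every l ∈ L can be written uniquely as l = l_1 + l_2 with l_1 ∈ K and l_2 ∈ L_0. -/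
open Matrix

namespace Refl

noncomputable section

variable {n : ℕ}

/-- ℂ-bilinear extension of the Gram pairing. -/
def cpair (B : Matrix (Fin n) (Fin n) ℤ) (Z W : Fin n → ℂ) : ℂ :=
  ∑ i, ∑ j, (B i j : ℂ) * Z i * W j

/-- ℚ-bilinear extension of the Gram pairing. -/
def qpair (B : Matrix (Fin n) (Fin n) ℤ) (x y : Fin n → ℚ) : ℚ :=
  ∑ i, ∑ j, (B i j : ℚ) * x i * y j

/-- ℝ-bilinear extension of the Gram pairing. -/
def rpair (B : Matrix (Fin n) (Fin n) ℤ) (x y : Fin n → ℝ) : ℝ :=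
  ∑ i, ∑ j, (B i j : ℝ) * x i * y j

def intQ (v : Fin n → ℤ) : Fin n → ℚ := fun i => (v i : ℚ)

def intR (v : Fin n → ℤ) : Fin n → ℝ := fun i => (v i : ℝ)

def intC (v : Fin n → ℤ) : Fin n → ℂ := fun i => (v i : ℂ)

def ratR (v : Fin n → ℚ) : Fin n → ℝ := fun i => (v i : ℝ)

def ratC (v : Fin n → ℚ) : Fin n → ℂ := fun i => (v i : ℂ)

/-- (v, v) for an integral vector. -/
def qnorm (B : Matrix (Fin n) (Fin n) ℤ) (v : Fin n → ℤ) : ℤ := v ⬝ᵥ B.mulVec v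

/-- Membership in the dual lattice (a vector of ℚ^n pairing integrally with the lattice). -/
def InDual (B : Matrix (Fin n) (Fin n) ℤ) (x : Fin n → ℚ) : Prop :=
  ∀ y : Fin n → ℤ, ∃ m : ℤ, qpair B x (intQ y) = (m : ℚ)

/-- A rational vector lies in the lattice ℤ^n itself. -/
def InLat (x : Fin n → ℚ) : Prop := ∃ w : Fin n → ℤ, x = intQ w

/-- `B` is the Gram matrix of an even nondegenerate lattice of signature (p,q). -/
def IsEvenLatticeOfSignature (B : Matrix (Fin n) (Fin n) ℤ) (p q : ℕ) : Prop :=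
  n = p + q ∧ B.IsSymm ∧ (∀ x : Fin n → ℤ, 2 ∣ qnorm B x) ∧ B.det ≠ 0 ∧
    ∃ P : Matrix (Fin n) (Fin n) ℝ, IsUnit P.det ∧
      Pᵀ * B.map (Int.cast : ℤ → ℝ) * P =
        Matrix.diagonal (fun i : Fin n => if (i : ℕ) < p then (1 : ℝ) else -1)

/-- `B` is the Gram matrix of an even positive-definite lattice. -/
def IsEvenPosDef (B : Matrix (Fin n) (Fin n) ℤ) : Prop :=
  B.IsSymm ∧ (∀ x : Fin n → ℤ, 2 ∣ qnorm B x) ∧ (B.map (Int.cast : ℤ → ℝ)).PosDef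

/-- The cone {Z | (Z,Z) = 0, (Z,conj Z) > 0}. -/
def Cone (B : Matrix (Fin n) (Fin n) ℤ) : Set (Fin n → ℂ) :=
  {Z | cpair B Z Z = 0 ∧ 0 < (cpair B Z (fun i => (starRingEnd ℂ) (Z i))).re}

/-- `D` is one of the connected components of the cone (the affine cone `D•(M)`). -/
def IsComponent (B : Matrix (Fin n) (Fin n) ℤ) (D : Set (Fin n → ℂ)) : Prop :=
  ∃ Z ∈ Cone B, D = connectedComponentIn (Cone B) Z

/-- The action of an integral matrix on ℂ^n. -/
def actC (g : Matrix (Fin n) (Fin n) ℤ) (Z : Fin n → ℂ) : Fin n → ℂ :=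
  (g.map (Int.cast : ℤ → ℂ)).mulVec Z

/-- The group O⁺(M): integral isometries preserving the chosen component. -/
def OPlus (B : Matrix (Fin n) (Fin n) ℤ) (D : Set (Fin n → ℂ)) :
    Set (Matrix (Fin n) (Fin n) ℤ) :=
  {g | gᵀ * B * g = B ∧ actC g '' D = D}

/-- The stable orthogonal group Õ⁺(M): elements of O⁺(M) acting trivially on M^∨/M. -/
def StableOPlus (B : Matrix (Fin n) (Fin n) ℤ) (D : Set (Fin n → ℂ)) :
    Set (Matrix (Fin n) (Fin n) ℤ) :=
  {g | g ∈ OPlus B D ∧ ∀ x : Fin n → ℚ, InDual B x →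
        ∃ w : Fin n → ℤ, (g.map (Int.cast : ℤ → ℚ)).mulVec x - x = intQ w}

/-- `Γ` is a finite-index subgroup of O⁺(M). -/
structure IsFiniteIndexSubgroup (B : Matrix (Fin n) (Fin n) ℤ) (D : Set (Fin n → ℂ))
    (Γ : Set (Matrix (Fin n) (Fin n) ℤ)) : Prop where
  subset : Γ ⊆ OPlus B D
  one_mem : (1 : Matrix (Fin n) (Fin n) ℤ) ∈ Γ
  mul_mem : ∀ g ∈ Γ, ∀ h ∈ Γ, g * h ∈ Γ
  inv_mem : ∀ g ∈ Γ, ∃ h ∈ Γ, g * h = 1 ∧ h * g = 1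
  finite_index : ∃ S : Finset (Matrix (Fin n) (Fin n) ℤ),
    ∀ g ∈ OPlus B D, ∃ s ∈ S, ∃ γ ∈ Γ, g = s * γ

/-- `χ` is a character Γ → ℂ× with finite image (equivalently, of finite order). -/
structure IsCharacter (Γ : Set (Matrix (Fin n) (Fin n) ℤ))
    (χ : Matrix (Fin n) (Fin n) ℤ → ℂ) : Prop where
  ne_zero : ∀ g ∈ Γ, χ g ≠ 0
  map_mul : ∀ g ∈ Γ, ∀ h ∈ Γ, χ (g * h) = χ g * χ h
  finite_image : (χ '' Γ).Finite

/-- `F` is a modular form of weight `k` and character `χ` for `Γ` on the component `D`. -/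
structure IsModularForm (B : Matrix (Fin n) (Fin n) ℤ) (D : Set (Fin n → ℂ))
    (Γ : Set (Matrix (Fin n) (Fin n) ℤ)) (χ : Matrix (Fin n) (Fin n) ℤ → ℂ)
    (k : ℤ) (F : (Fin n → ℂ) → ℂ) : Prop where
  holo : DifferentiableOn ℂ F D
  homogeneous : ∀ t : ℂ, t ≠ 0 → ∀ Z ∈ D, F (t • Z) = t ^ (-k) * F Z
  equivariant : ∀ g ∈ Γ, ∀ Z ∈ D, F (actC g Z) = χ g * F Z

def NonConstantOn (D : Set (Fin n → ℂ)) (F : (Fin n → ℂ) → ℂ) : Prop :=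
  ¬ ∃ c : ℂ, ∀ Z ∈ D, F Z = c

/-- `Z` lies on the rational quadratic divisor of the integral vector `v`. -/
def OrthZ (B : Matrix (Fin n) (Fin n) ℤ) (Z : Fin n → ℂ) (v : Fin n → ℤ) : Prop :=
  cpair B Z (intC v) = 0

/-- `F` is nonconstant and its zero set is contained in hyperplanes of (-2)-vectors. -/
def Is2ReflectiveForm (B : Matrix (Fin n) (Fin n) ℤ) (D : Set (Fin n → ℂ))
    (F : (Fin n → ℂ) → ℂ) : Prop :=
  NonConstantOn D F ∧
    ∀ Z ∈ D, F Z = 0 → ∃ v : Fin n → ℤ, qnorm B v = -2 ∧ OrthZ B Z v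

/-- The lattice is 2-reflective. -/
def Is2Reflective (B : Matrix (Fin n) (Fin n) ℤ) : Prop :=
  ∃ D : Set (Fin n → ℂ), IsComponent B D ∧
    ∃ (Γ : Set (Matrix (Fin n) (Fin n) ℤ)) (χ : Matrix (Fin n) (Fin n) ℤ → ℂ)
      (k : ℤ) (F : (Fin n → ℂ) → ℂ),
      IsFiniteIndexSubgroup B D Γ ∧ IsCharacter Γ χ ∧
      IsModularForm B D Γ χ k F ∧ Is2ReflectiveForm B D F

/-- Primitivity of an integral vector : ℚv ∩ ℤ^n = ℤv. -/
def IsPrimitive (v : Fin n → ℤ) : Prop :=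
  v ≠ 0 ∧ ∀ (a : ℚ) (w : Fin n → ℤ), (∀ i, a * (v i : ℚ) = (w i : ℚ)) →
    ∃ m : ℤ, w = m • v

/-- The reflection σ_v maps the lattice into itself. -/
def ReflPreservesLat (B : Matrix (Fin n) (Fin n) ℤ) (v : Fin n → ℤ) : Prop :=
  ∀ x : Fin n → ℤ, ∃ y : Fin n → ℤ, ∀ i,
    (x i : ℚ) - (2 * ((x ⬝ᵥ B.mulVec v : ℤ) : ℚ) / (qnorm B v : ℚ)) * (v i : ℚ) = (y i : ℚ)

/-- The ℂ-linear extension of the reflection σ_v. -/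
def reflC (B : Matrix (Fin n) (Fin n) ℤ) (v : Fin n → ℤ) (Z : Fin n → ℂ) : Fin n → ℂ :=
  fun i => Z i - (2 * cpair B Z (intC v) / (qnorm B v : ℂ)) * (v i : ℂ)

/-- `v` is a reflective vector of the lattice `M` (w.r.t. the component `D`). -/
def IsReflectiveVector (B : Matrix (Fin n) (Fin n) ℤ) (D : Set (Fin n → ℂ))
    (v : Fin n → ℤ) : Prop :=
  IsPrimitive v ∧ qnorm B v < 0 ∧ ReflPreservesLat B v ∧ reflC B v '' D = D

/-- `F` is nonconstant and its zero set is contained in hyperplanes of reflective vectors. -/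
def IsReflectiveForm (B : Matrix (Fin n) (Fin n) ℤ) (D : Set (Fin n → ℂ))
    (F : (Fin n → ℂ) → ℂ) : Prop :=
  NonConstantOn D F ∧
    ∀ Z ∈ D, F Z = 0 → ∃ v : Fin n → ℤ, IsReflectiveVector B D v ∧ OrthZ B Z v

/-- The lattice is reflective. -/
def IsReflective (B : Matrix (Fin n) (Fin n) ℤ) : Prop :=
  ∃ D : Set (Fin n → ℂ), IsComponent B D ∧
    ∃ (Γ : Set (Matrix (Fin n) (Fin n) ℤ)) (χ : Matrix (Fin n) (Fin n) ℤ → ℂ)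
      (k : ℤ) (F : (Fin n → ℂ) → ℂ),
      IsFiniteIndexSubgroup B D Γ ∧ IsCharacter Γ χ ∧
      IsModularForm B D Γ χ k F ∧ IsReflectiveForm B D F

/-- Isomorphism of lattices given by Gram matrices. -/
def LatIso {m n : ℕ} (A : Matrix (Fin m) (Fin m) ℤ) (B : Matrix (Fin n) (Fin n) ℤ) : Prop :=
  ∃ e : (Fin m → ℤ) ≃ₗ[ℤ] (Fin n → ℤ), ∀ x y : Fin m → ℤ,
    e x ⬝ᵥ B.mulVec (e y) = x ⬝ᵥ A.mulVec y

/-- Orthogonal direct sum of lattices. -/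
def dsum {m n : ℕ} (A : Matrix (Fin m) (Fin m) ℤ) (B : Matrix (Fin n) (Fin n) ℤ) :
    Matrix (Fin (m + n)) (Fin (m + n)) ℤ :=
  Matrix.reindex finSumFinEquiv finSumFinEquiv (Matrix.fromBlocks A 0 0 B)

/-- The hyperbolic plane U. -/
def U : Matrix (Fin 2) (Fin 2) ℤ := !![0, 1; 1, 0]

/-- Gram matrix of the root lattice A_m. -/
def gramA (m : ℕ) : Matrix (Fin m) (Fin m) ℤ :=
  Matrix.of fun i j =>
    if i = j then 2 else if i.val + 1 = j.val ∨ j.val + 1 = i.val then -1 else 0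

/-- Gram matrix of the root lattice D_m. -/
def gramD (m : ℕ) : Matrix (Fin m) (Fin m) ℤ :=
  Matrix.of fun i j =>
    if i = j then 2
    else if (i.val + 1 = j.val ∧ j.val + 1 ≠ m) ∨ (j.val + 1 = i.val ∧ i.val + 1 ≠ m) then -1
    else if (i.val + 3 = m ∧ j.val + 1 = m) ∨ (j.val + 3 = m ∧ i.val + 1 = m) then -1
    else 0

/-- Gram matrix of the root lattice E_6. -/
def gramE6 : Matrix (Fin 6) (Fin 6) ℤ :=
  !![2, -1, 0, 0, 0, 0;
     -1, 2, -1, 0, 0, 0;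
     0, -1, 2, -1, 0, -1;
     0, 0, -1, 2, -1, 0;
     0, 0, 0, -1, 2, 0;
     0, 0, -1, 0, 0, 2]

/-- Gram matrix of the root lattice E_7. -/
def gramE7 : Matrix (Fin 7) (Fin 7) ℤ :=
  !![2, -1, 0, 0, 0, 0, 0;
     -1, 2, -1, 0, 0, 0, 0;
     0, -1, 2, -1, 0, 0, -1;
     0, 0, -1, 2, -1, 0, 0;
     0, 0, 0, -1, 2, -1, 0;
     0, 0, 0, 0, -1, 2, 0;
     0, 0, -1, 0, 0, 0, 2]

/-- Gram matrix of the root lattice E_8. -/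
def gramE8 : Matrix (Fin 8) (Fin 8) ℤ :=
  !![2, -1, 0, 0, 0, 0, 0, 0;
     -1, 2, -1, 0, 0, 0, 0, 0;
     0, -1, 2, -1, 0, 0, 0, -1;
     0, 0, -1, 2, -1, 0, 0, 0;
     0, 0, 0, -1, 2, -1, 0, 0;
     0, 0, 0, 0, -1, 2, -1, 0;
     0, 0, 0, 0, 0, -1, 2, 0;
     0, 0, -1, 0, 0, 0, 0, 2]

/-- Gram matrix of the Nikulin lattice N_8 (basis a_1,…,a_7,h with h=(a_1+⋯+a_8)/2). -/
def gramN8 : Matrix (Fin 8) (Fin 8) ℤ :=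
  Matrix.of fun i j =>
    if i = j then (if i.val = 7 then 4 else 2)
    else if i.val = 7 ∨ j.val = 7 then 1 else 0

/-- The lattice M = 2U ⊕ L(−1). -/
def M2U {r : ℕ} (L : Matrix (Fin r) (Fin r) ℤ) :
    Matrix (Fin (2 + (2 + r))) (Fin (2 + (2 + r))) ℤ :=
  dsum U (dsum U (-L))

/-- div(v) = d : the ideal (v, M) of ℤ is generated by d. -/
def DivEq (B : Matrix (Fin n) (Fin n) ℤ) (v : Fin n → ℤ) (d : ℤ) : Prop :=
  Ideal.span {a : ℤ | ∃ x : Fin n → ℤ, a = v ⬝ᵥ B.mulVec x} = Ideal.span {d}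

/-- Sum-of-divisors function σ₁ (on nonnegative integers). -/
def sigma1 (m : ℤ) : ℤ := ∑ d ∈ m.toNat.divisors, (d : ℤ)

end

end Refl


namespace Refl

/-- If `l` pairs integrally with every vector of `ℚN` dual to the lattice `N` spanned by a linearly
independent family, then the orthogonal projection of `l` to `ℚN` lies in `N`. -/
lemma exists_mem_span_int_orthogonal {V ι : Type*} [AddCommGroup V] [Module ℚ V] [Finite ι]
    (Q : LinearMap.BilinForm ℚ V) (hQ : Q.IsSymm) (hani : ∀ x, Q x x = 0 → x = 0)
    (v : ι → V) (hv : LinearIndependent ℚ v) (l : V)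
    (hl : ∀ x ∈ Submodule.span ℚ (Set.range v),
      (∀ k ∈ Submodule.span ℤ (Set.range v), ∃ m : ℤ, Q x k = m) → ∃ m : ℤ, Q x l = m) :
    ∃ k ∈ Submodule.span ℤ (Set.range v), ∀ x ∈ Submodule.span ℚ (Set.range v),
      Q x (l - k) = 0 := by
  let W := Submodule.span ℚ (Set.range v)
  let b : Module.Basis ι ℚ W := Module.Basis.span hv
  have hb (i : ι) : (b i : V) = v i := congrArg Subtype.val (Module.Basis.span_apply hv i)
  have : FiniteDimensional ℚ W := b.finiteDimensional_of_finite
  let R : LinearMap.BilinForm ℚ W := Q.restrict W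
  have hR (x y : W) : R x y = Q x y := rfl
  have hsymm : R.IsSymm := ⟨fun x y => hQ.eq x y⟩
  have hnondeg : R.Nondegenerate :=
    ⟨fun x hx => Subtype.ext (hani x (hx x)), fun x hx => Subtype.ext (hani x (hx x))⟩
  have hmap : (Submodule.span ℤ (Set.range b)).map (W.subtype.restrictScalars ℤ) =
      Submodule.span ℤ (Set.range v) := by
    rw [Submodule.map_span, ← Set.range_comp]
    congr 2
    exact funext hb
  let p : W := (R.toDual hnondeg).symm (Q l ∘ₗ W.subtype)
  have hp (x : W) : R p x = Q l x :=
    LinearMap.BilinForm.apply_toDual_symm_apply (Q l ∘ₗ W.subtype) x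
  have hpmem : p ∈ Submodule.span ℤ (Set.range b) := by
    rw [← R.dualSubmodule_dualSubmodule_of_basis hnondeg hsymm b,
      LinearMap.BilinForm.mem_dualSubmodule]
    intro x hx
    obtain ⟨m, hm⟩ := hl x x.2 fun k hk => by
      rw [← hmap] at hk
      obtain ⟨y, hy, rfl⟩ := hk
      obtain ⟨m, hm⟩ := Submodule.mem_one.mp (hx y hy)
      exact ⟨m, hm.symm⟩
    exact Submodule.mem_one.mpr ⟨m, by rw [hp, ← hQ.eq]; exact hm.symm⟩
  refine ⟨p, hmap ▸ Submodule.mem_map_of_mem hpmem, fun x hx => ?_⟩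
  have h := hp ⟨x, hx⟩
  rw [hR] at h
  have h₁ : Q x l = Q l x := hQ.eq x l
  have h₂ : Q x p = Q p x := hQ.eq x p
  rw [map_sub, h₁, h₂, h, sub_self]

/-- `intQ` as a `ℤ`-linear map. -/
def intQLin (n : ℕ) : (Fin n → ℤ) →ₗ[ℤ] (Fin n → ℚ) :=
  (Algebra.linearMap ℤ ℚ).compLeft (Fin n)

lemma intQLin_apply {n : ℕ} (v : Fin n → ℤ) : intQLin n v = intQ v := rfl

lemma intQLin_injective (n : ℕ) : Function.Injective (intQLin n) :=
  fun _ _ h => funext fun i => Int.cast_injective (congrFun h i)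

lemma qpair_eq_toBilin' {n : ℕ} (B : Matrix (Fin n) (Fin n) ℤ) (x y : Fin n → ℚ) :
    qpair B x y = Matrix.toBilin' (B.map (Int.cast : ℤ → ℚ)) x y := by
  rw [Matrix.toBilin'_apply]
  simp only [qpair, Matrix.map_apply, mul_comm (x _)]

lemma qpair_intQ {n : ℕ} (B : Matrix (Fin n) (Fin n) ℤ) (x y : Fin n → ℤ) :
    qpair B (intQ x) (intQ y) = ((x ⬝ᵥ B.mulVec y : ℤ) : ℚ) := by
  simp only [qpair, intQ, dotProduct, Matrix.mulVec, Finset.mul_sum]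
  push_cast
  exact Finset.sum_congr rfl fun i _ => Finset.sum_congr rfl fun j _ => by ring

lemma qpair_comm {n : ℕ} {B : Matrix (Fin n) (Fin n) ℤ} (hB : B.IsSymm) (x y : Fin n → ℚ) :
    qpair B x y = qpair B y x := by
  unfold qpair
  rw [Finset.sum_comm]
  exact Finset.sum_congr rfl fun i _ => Finset.sum_congr rfl fun j _ => by
    rw [hB.apply i j]; ring

lemma IsEvenPosDef.eq_zero_of_qpair_self {n : ℕ} {B : Matrix (Fin n) (Fin n) ℤ}
    (hB : IsEvenPosDef B) {x : Fin n → ℚ} (hx : qpair B x x = 0) : x = 0 := by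
  by_contra hne
  have hne' : ratR x ≠ 0 := fun h => hne (funext fun i => Rat.cast_injective (α := ℝ) (by
    simpa [ratR] using congrFun h i))
  refine (hB.2.2.dotProduct_mulVec_pos hne').ne' ?_
  have h : ((qpair B x x : ℚ) : ℝ) = 0 := by rw [hx, Rat.cast_zero]
  rw [← h]
  simp only [qpair, ratR, dotProduct, Matrix.mulVec, Finset.mul_sum, Matrix.map_apply,
    Pi.star_apply, star_trivial]
  push_cast
  exact Finset.sum_congr rfl fun i _ => Finset.sum_congr rfl fun j _ => by ring

/-- If K is a nonzero sublattice of an even positive-definite lattice L with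
K^∨ ⊆ L^∨ inside L ⊗ ℚ, then L splits as the internal orthogonal direct sum of K and
L₀ = K^⊥ ∩ L. -/
theorem orthogonal_splitting {r : ℕ} (B : Matrix (Fin r) (Fin r) ℤ) (hB : IsEvenPosDef B)
    (K : Submodule ℤ (Fin r → ℤ)) (hK : K ≠ ⊥)
    (hdual : ∀ x : Fin r → ℚ,
      x ∈ Submodule.span ℚ (intQ '' (K : Set (Fin r → ℤ))) →
      (∀ k ∈ K, ∃ m : ℤ, qpair B x (intQ k) = (m : ℚ)) →
      ∀ y : Fin r → ℤ, ∃ m : ℤ, qpair B x (intQ y) = (m : ℚ)) :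
    ∀ l : Fin r → ℤ, ∃! p : (Fin r → ℤ) × (Fin r → ℤ),
      p.1 ∈ K ∧ (∀ k ∈ K, p.2 ⬝ᵥ B.mulVec k = 0) ∧ l = p.1 + p.2 := by
  intro l
  let b := Module.Free.chooseBasis ℤ K
  let v := fun i => intQ (b i : Fin r → ℤ)
  have hv : LinearIndependent ℚ v := by
    rw [← LinearIndependent.iff_fractionRing (R := ℤ)]
    exact b.linearIndependent.map' (intQLin r ∘ₗ K.subtype)
      (LinearMap.ker_eq_bot.mpr ((intQLin_injective r).comp K.injective_subtype))
  have hZ : Submodule.span ℤ (Set.range v) = K.map (intQLin r) := by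
    have hrange : Set.range v = (intQLin r ∘ₗ K.subtype) '' Set.range b := by
      rw [← Set.range_comp]; rfl
    rw [hrange, Submodule.span_image, b.span_eq, Submodule.map_comp, Submodule.map_top,
      Submodule.range_subtype]
  have hspan : Submodule.span ℚ (Set.range v) =
      Submodule.span ℚ (intQ '' (K : Set (Fin r → ℤ))) := by
    rw [← Submodule.span_span_of_tower ℤ ℚ, hZ]
    rfl
  have hKmem {k : Fin r → ℤ} (hk : k ∈ K) : intQ k ∈ Submodule.span ℤ (Set.range v) :=
    hZ ▸ Submodule.mem_map_of_mem (f := intQLin r) hk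
  obtain ⟨k, hk, hort⟩ := exists_mem_span_int_orthogonal
    (Matrix.toBilin' (B.map (Int.cast : ℤ → ℚ)))
    ⟨fun x y => by simpa only [qpair_eq_toBilin'] using qpair_comm hB.1 x y⟩
    (fun x hx => hB.eq_zero_of_qpair_self (by rw [qpair_eq_toBilin', hx])) v hv (intQ l)
    (by
      simp only [← qpair_eq_toBilin']
      exact fun x hx hint => hdual x (hspan ▸ hx) (fun k hk => hint _ (hKmem hk)) l)
  rw [hZ] at hk
  obtain ⟨k, hk, rfl⟩ := hk
  have hperp (j : Fin r → ℤ) (hj : j ∈ K) : (l - k) ⬝ᵥ B.mulVec j = 0 := by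
    have h := hort (intQ j) (hspan ▸ Submodule.subset_span ⟨j, hj, rfl⟩)
    rw [← intQLin_apply l, ← map_sub, intQLin_apply, ← qpair_eq_toBilin', qpair_comm hB.1,
      qpair_intQ] at h
    exact_mod_cast h
  refine ⟨(k, l - k), ⟨hk, hperp, (add_sub_cancel k l).symm⟩, ?_⟩
  rintro ⟨a, c⟩ ⟨ha, hc, rfl⟩
  have hzero : a - k = 0 := by
    apply intQLin_injective r
    rw [map_zero, intQLin_apply]
    apply hB.eq_zero_of_qpair_self
    have h₁ := hperp (a - k) (K.sub_mem ha hk)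
    have h₂ := hc (a - k) (K.sub_mem ha hk)
    rw [add_sub_right_comm, add_dotProduct, h₂, add_zero] at h₁
    rw [qpair_intQ, h₁, Int.cast_zero]
  obtain rfl := sub_eq_zero.mp hzero
  simp

end Refl
end

section
/- Let M be an even lattice of signature (n,2) with n ≥ 3, and let l(D(M)) be the minimal number of generators of the finite abelian discriminant group D(M) = M^∨/M. If n − 2 > l(D(M)), then there exists an even positive-definite lattice L of rank n − 2 such that M is isomorphic to U ⊕ U ⊕ L. -/
open Matrix

namespace Refl

theorem exists_abs_add_two_mul_le (A B : ℤ) (hA : A ≠ 0) : ∃ k : ℤ, |B + 2 * A * k| ≤ |A| := by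
  refine ⟨-((B + |A|) / (2 * A)), ?_⟩
  have h1 := Int.emod_nonneg (B + |A|) (b := 2 * A) (by omega)
  have h2 := Int.emod_lt_abs (B + |A|) (b := 2 * A) (by omega)
  have h3 := Int.emod_add_mul_ediv (B + |A|) (2 * A)
  rw [abs_mul, abs_two] at h2
  rw [abs_le]
  constructor <;> linarith

/-- An integral binary quadratic form represents primitively a value that is small with respect
to its discriminant. -/
theorem exists_small_value_binary (A B C : ℤ) :
    ∃ p q r s : ℤ, p * s - q * r = 1 ∧
      3 * (A * p ^ 2 + B * p * q + C * q ^ 2) ^ 2 ≤ |B ^ 2 - 4 * A * C| := by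
  induction hn : A.natAbs using Nat.strong_induction_on generalizing A B C with
  | _ n ih =>
  subst hn
  rcases eq_or_ne A 0 with rfl | hA
  · exact ⟨1, 0, 0, 1, by norm_num, by simp [sq_nonneg]⟩
  obtain ⟨k, hk⟩ := exists_abs_add_two_mul_le A B hA
  by_cases hD : 3 * A ^ 2 ≤ |B ^ 2 - 4 * A * C|
  · exact ⟨1, 0, 0, 1, by norm_num, by simpa using hD⟩
  push Not at hD
  set B' := B + 2 * A * k with hB'
  set C' := A * k ^ 2 + B * k + C with hC'
  have hdisc : B ^ 2 - 4 * A * C = B' ^ 2 - 4 * A * C' := by rw [hB', hC']; ring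
  have hlt : |C'| < |A| := by
    have h1 : B' ^ 2 ≤ A ^ 2 := sq_le_sq.2 hk
    have h2 : |4 * A * C'| ≤ |B' ^ 2 - 4 * A * C'| + B' ^ 2 := by
      have := abs_sub (B' ^ 2) (B' ^ 2 - 4 * A * C')
      rw [abs_of_nonneg (sq_nonneg B')] at this
      calc _ = |B' ^ 2 - (B' ^ 2 - 4 * A * C')| := by congr 1; ring
        _ ≤ _ := this
        _ = _ := by ring
    rw [← hdisc] at h2
    have h3 : |4 * A * C'| < 4 * A ^ 2 := by linarith
    rw [abs_mul, abs_mul, ← sq_abs A] at h3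
    have hA' : 0 < |A| := abs_pos.2 hA
    norm_num at h3
    rw [← sq_abs A] at h3
    nlinarith
  obtain ⟨p, q, r, s, h1, h2⟩ := ih C'.natAbs (by zify; exact hlt) C' (-B') A rfl
  refine ⟨k * p - q, p, k * r - s, r, by linear_combination h1, ?_⟩
  rw [hdisc]
  have e1 : A * (k * p - q) ^ 2 + B * (k * p - q) * p + C * p ^ 2 =
      C' * p ^ 2 + -B' * p * q + A * q ^ 2 := by rw [hB', hC']; ring
  rw [e1]
  convert h2 using 2
  ring

/-- A ternary integral quadratic form of half-discriminant `±1` is isotropic. -/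
theorem exists_zero_ternary_of_unimodular (a b c d e f : ℤ)
    (h : |4 * a * b * c + d * e * f - a * d ^ 2 - b * e ^ 2 - c * f ^ 2| = 1) :
    ∃ x y z : ℤ, (x ≠ 0 ∨ y ≠ 0 ∨ z ≠ 0) ∧
      a * x ^ 2 + b * y ^ 2 + c * z ^ 2 + d * y * z + e * x * z + f * x * y = 0 := by
  induction hn : a.natAbs using Nat.strong_induction_on generalizing a b c d e f with
  | _ n ih =>
  subst hn
  rcases eq_or_ne a 0 with rfl | ha
  · exact ⟨1, 0, 0, by simp, by ring⟩
  obtain ⟨p, q, r, s, h1, h2⟩ :=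
    exists_small_value_binary (4 * a * b - f ^ 2) (4 * a * d - 2 * e * f) (4 * a * c - e ^ 2)
  have hG : |(4 * a * d - 2 * e * f) ^ 2 - 4 * (4 * a * b - f ^ 2) * (4 * a * c - e ^ 2)|
      = 16 * |a| := by
    have : (4 * a * d - 2 * e * f) ^ 2 - 4 * (4 * a * b - f ^ 2) * (4 * a * c - e ^ 2)
      = -16 * a * (4 * a * b * c + d * e * f - a * d ^ 2 - b * e ^ 2 - c * f ^ 2) := by ring
    rw [this, abs_mul, h, abs_mul]; simp
  rw [hG] at h2
  set g := (4 * a * b - f ^ 2) * p ^ 2 + (4 * a * d - 2 * e * f) * p * q +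
    (4 * a * c - e ^ 2) * q ^ 2 with hg
  obtain ⟨X, hX⟩ := exists_abs_add_two_mul_le a (f * p + e * q) ha
  set t := f * p + e * q + 2 * a * X with ht
  set a' := a * X ^ 2 + b * p ^ 2 + c * q ^ 2 + d * p * q + e * X * q + f * X * p with ha'
  have key : 4 * a * a' = t ^ 2 + g := by rw [ht, hg, ha']; ring
  have hlt : |a'| < |a| := by
    have hA' : 0 < |a| := abs_pos.2 ha
    have h3 : t ^ 2 ≤ |a| ^ 2 := by rw [sq_abs]; exact sq_le_sq.2 hX
    have h4 : 4 * |a| * |a'| ≤ t ^ 2 + |g| := by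
      have : |4 * a * a'| ≤ |t ^ 2| + |g| := by rw [key]; exact abs_add_le _ _
      rwa [abs_mul, abs_mul, abs_of_nonneg (sq_nonneg t)] at this
    have h5 : 3 * |g| ^ 2 ≤ 16 * |a| := by rwa [sq_abs]
    by_contra hcon
    push Not at hcon
    have h6 : 3 * |a| ^ 2 ≤ |g| := by nlinarith
    have h7 : 1 ≤ |a| := hA'
    have h8 : 3 * |a| ≤ |g| := by nlinarith
    nlinarith
  obtain ⟨x, y, z, hne, hz⟩ := ih a'.natAbs (by zify; exact hlt) a' a (b * r ^ 2 + d * r * s + c * s ^ 2)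
    (f * r + e * s) (X * (f * r + e * s) + 2 * b * p * r + d * (p * s + q * r) + 2 * c * q * s)
    t (by
      rw [← h]
      have : 4 * a * b * c + d * e * f - a * d ^ 2 - b * e ^ 2 - c * f ^ 2 =
        (p * s - q * r) ^ 2 *
          (4 * a * b * c + d * e * f - a * d ^ 2 - b * e ^ 2 - c * f ^ 2) := by rw [h1]; ring
      rw [this, ht, ha']
      congr 1
      ring) rfl
  refine ⟨X * x + y, p * x + r * z, q * x + s * z, ?_, ?_⟩
  · by_contra hcon
    push Not at hcon
    obtain ⟨i1, i2, i3⟩ := hcon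
    have hx : x = 0 := by linear_combination s * i2 - r * i3 - x * h1
    have hz : z = 0 := by linear_combination p * i3 - q * i2 - z * h1
    simp only [hx, mul_zero, zero_add] at i1
    simp [hx, i1, hz] at hne
  · rw [← hz, ht, ha']; ring

theorem isCoprime_of_prime_not_dvd {q : ℕ} (hq : q.Prime) {m : ℤ} (h : ¬ (q : ℤ) ∣ m) :
    IsCoprime (q : ℤ) m :=
  ((Nat.prime_iff_prime_int.1 hq).coprime_iff_not_dvd).2 h

/-- The discriminant of `[a, b, c]` is a square modulo a prime `q` that the form represents modulo
four times the discriminant. -/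
theorem exists_root_mod_prime {a b c : ℤ} (ha : 0 < a) {q : ℕ} (hq : q.Prime)
    (hqΔ : ¬ (q : ℤ) ∣ 4 * (b ^ 2 - 4 * a * c)) (hqa : ¬ (q : ℤ) ∣ a) {j : ℤ}
    (hcop : IsCoprime (a * j ^ 2) (4 * (b ^ 2 - 4 * a * c)))
    (hj : (q : ℤ) ≡ a * j ^ 2 [ZMOD 4 * (b ^ 2 - 4 * a * c)]) :
    ∃ ρ : ℤ, (q : ℤ) ∣ a * ρ ^ 2 + b * ρ + c := by
  set Δ := b ^ 2 - 4 * a * c with hΔ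
  have := Fact.mk hq
  have hq2 : q ≠ 2 := by
    rintro rfl
    exact hqΔ (Dvd.intro (2 * Δ) (by push_cast; ring))
  have hqodd : Odd q := hq.odd_of_ne_two hq2
  have ha' : a = (a.natAbs : ℤ) := by omega
  have hN : Odd (a.natAbs * j.natAbs ^ 2) := by
    rw [← Nat.not_even_iff_odd, even_iff_two_dvd]
    intro h
    have h2 : (2 : ℤ) ∣ a * j ^ 2 := by
      have := Int.natCast_dvd_natCast.2 h
      push_cast at this
      rwa [sq_abs, abs_of_pos ha] at this
    have := hcop.isUnit_of_dvd' h2 (Dvd.intro (2 * Δ) (by ring))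
    rw [Int.isUnit_iff] at this
    omega
  have hcopa : IsCoprime a Δ := (IsCoprime.of_mul_left_left hcop).of_mul_right_right
  have hcopj : IsCoprime j Δ :=
    ((IsCoprime.pow_left_iff two_pos).1 (IsCoprime.of_mul_left_right hcop)).of_mul_right_right
  have hba : IsCoprime b a := by
    obtain ⟨u, v, h⟩ := hcopa
    exact ⟨v * b, u - 4 * v * c, by rw [hΔ] at h; linear_combination h⟩
  have hJ : jacobiSym Δ q = 1 := by
    have e1 : q % (4 * Δ.natAbs) = (a.natAbs * j.natAbs ^ 2) % (4 * Δ.natAbs) := by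
      have h0 : (4 * Δ) ∣ (a * j ^ 2 - q) := hj.dvd
      have h1 : (q : ℤ) ≡ ((a.natAbs * j.natAbs ^ 2 : ℕ) : ℤ) [ZMOD ((4 * Δ.natAbs : ℕ) : ℤ)] := by
        rw [Int.modEq_iff_dvd]
        push_cast
        rw [sq_abs, abs_of_pos ha, ← abs_dvd] at *
        simpa [abs_mul] using h0
      exact (Int.natCast_modEq_iff.1 h1)
    rw [jacobiSym.mod_right Δ hqodd, e1, ← jacobiSym.mod_right Δ hN, jacobiSym.mul_right',
      jacobiSym.pow_right, jacobiSym.sq_one, mul_one]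
    · have : jacobiSym Δ a.natAbs = jacobiSym (b ^ 2) a.natAbs := by
        apply jacobiSym.mod_left'
        rw [← ha', hΔ]
        exact Int.modEq_iff_dvd.2 ⟨4 * c, by ring⟩
      rw [this, jacobiSym.sq_one']
      rw [← Int.isCoprime_iff_gcd_eq_one, ← ha']
      exact hba
    · have := hcopj.symm
      rw [Int.isCoprime_iff_gcd_eq_one] at this
      simpa [Int.gcd, Int.natAbs_abs] using this
    · omega
    · intro h
      have : j.natAbs = 0 := by simpa using h
      rw [this] at hN
      simp at hN
  obtain ⟨s', hs'⟩ := ZMod.isSquare_of_jacobiSym_eq_one hJ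
  obtain ⟨s, rfl⟩ := ZMod.intCast_surjective s'
  have hs : (q : ℤ) ∣ Δ - s * s := by
    rw [← ZMod.intCast_zmod_eq_zero_iff_dvd]
    push_cast
    rw [hs', sub_self]
  have hc4 : IsCoprime (q : ℤ) 4 := (isCoprime_of_prime_not_dvd hq hqΔ).of_mul_right_left
  have hc2 : IsCoprime (q : ℤ) 2 := by
    apply hc4.of_isCoprime_of_dvd_right
    norm_num
  have hca := isCoprime_of_prime_not_dvd hq hqa
  obtain ⟨β, α, h1⟩ := hc2.mul_right hca
  refine ⟨(s - b) * α, ?_⟩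
  have h4 : (q : ℤ) ∣ (4 * a) * (a * ((s - b) * α) ^ 2 + b * ((s - b) * α) + c) := by
    obtain ⟨w, hw⟩ := hs
    have hw2 : (α * (2 * a)) = 1 - β * q := by linear_combination h1
    refine ⟨-w + (s-b) * (-β) * (2 * s + (s - b) * (-β) * q), ?_⟩
    have : (4 * a) * (a * ((s - b) * α) ^ 2 + b * ((s - b) * α) + c) =
      ((s - b) * (α * (2 * a)) + b) ^ 2 - Δ := by rw [hΔ]; ring
    rw [this, hw2]
    linear_combination (-1 : ℤ) * hw
  exact (hc4.mul_right hca).dvd_of_dvd_mul_left h4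

theorem exists_sq_congr_aux {a b c : ℤ} (hcop : IsCoprime a (b ^ 2 - 4 * a * c)) :
    ∃ κ κ' Δ' h : ℤ, κ ≠ 0 ∧ 2 = κ * κ' ∧ b ^ 2 - 4 * a * c = κ ^ 2 * Δ' ∧
      b ^ 2 - 4 * a * c ∣ b * κ - 2 * a * h ∧
      b ^ 2 - 4 * a * c ∣ c * κ ^ 2 - a * h ^ 2 := by
  set Δ := b ^ 2 - 4 * a * c with hΔ
  rcases Int.even_or_odd b with hb | hb
  · obtain ⟨b0, hb0⟩ := hb
    obtain ⟨u, v, h⟩ := hcop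
    refine ⟨2, 1, b0 ^ 2 - a * c, u * b, by norm_num, by norm_num,
      by rw [hΔ, hb0]; ring, ⟨2 * b * v, by linear_combination (-2 * b) * h⟩, ?_⟩
    have : Δ ∣ a * (c * 2 ^ 2 - a * (u * b) ^ 2) :=
      ⟨-1 + b * v * (b + a * u * b), by linear_combination (-b * (b + a * u * b)) * h - hΔ⟩
    exact (IsCoprime.symm ⟨u, v, h⟩).dvd_of_dvd_mul_left this
  · have h2 : IsCoprime (2 : ℤ) Δ := by
      obtain ⟨t, ht⟩ := hb
      exact ⟨-2 * t ^ 2 - 2 * t + 2 * a * c, 1, by rw [hΔ, ht]; ring⟩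
    have h2a := h2.mul_left hcop
    have h4a := h2.mul_left h2a
    obtain ⟨u, v, h⟩ := h2a
    refine ⟨1, 2, Δ, u * b, by norm_num, by norm_num, by ring,
      ⟨b * v, by linear_combination (-b) * h⟩, ?_⟩
    have : Δ ∣ (2 * (2 * a)) * (c * 1 ^ 2 - a * (u * b) ^ 2) :=
      ⟨-1 + b * v * (b + 2 * a * u * b), by
        linear_combination (-b * (b + 2 * a * u * b)) * h - hΔ⟩
    exact h4a.symm.dvd_of_dvd_mul_left this

/-- A special case of the theorem of Legendre: if a prime `q` is congruent to `a * j ^ 2` modulo four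
times the discriminant of `[a, b, c]`, then `[a, b, c] - q Z ^ 2` is isotropic. -/
theorem exists_represents_prime_mul_sq {a b c : ℤ} (ha : 0 < a) (hΔ0 : b ^ 2 - 4 * a * c ≠ 0)
    {q : ℕ} (hq : q.Prime) (hqΔ : ¬ (q : ℤ) ∣ 4 * (b ^ 2 - 4 * a * c)) (hqa : ¬ (q : ℤ) ∣ a) {j : ℤ}
    (hj : (q : ℤ) ≡ a * j ^ 2 [ZMOD 4 * (b ^ 2 - 4 * a * c)]) :
    ∃ X Y Z : ℤ, (X ≠ 0 ∨ Y ≠ 0 ∨ Z ≠ 0) ∧ a * X ^ 2 + b * X * Y + c * Y ^ 2 = q * Z ^ 2 := by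
  obtain ⟨t, ht⟩ := hj.dvd
  have hcq := isCoprime_of_prime_not_dvd hq hqΔ
  have hcop : IsCoprime (a * j ^ 2) (4 * (b ^ 2 - 4 * a * c)) := by
    obtain ⟨u, v, h⟩ := hcq
    exact ⟨u, v - u * t, by linear_combination h + u * ht⟩
  obtain ⟨ρ, ρ', hρ⟩ := exists_root_mod_prime ha hq hqΔ hqa hcop hj
  have hcopa : IsCoprime a (b ^ 2 - 4 * a * c) :=
    (IsCoprime.of_mul_left_left hcop).of_mul_right_right
  obtain ⟨τ, ν, hτ⟩ : IsCoprime j (b ^ 2 - 4 * a * c) :=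
    ((IsCoprime.pow_left_iff two_pos).1 (IsCoprime.of_mul_left_right hcop)).of_mul_right_right
  obtain ⟨κ, κ', Δ', h, hκ0, hκ, hΔ', ⟨m1, hm1⟩, ⟨m2, hm2⟩⟩ := exists_sq_congr_aux hcopa
  set Δ := b ^ 2 - 4 * a * c with hΔ
  have hq0 : (q : ℤ) ≠ 0 := by exact_mod_cast hq.ne_zero
  have hdvd : ∀ y s r : ℤ, (q : ℤ) * Δ ∣ a * (κ * ρ * y + q * s) ^ 2 +
      b * (κ * ρ * y + q * s) * (κ * y) + c * (κ * y) ^ 2 -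
      q * (τ * (κ * ρ * y + q * s + h * y) + κ * Δ' * r) ^ 2 := by
    intro y s r
    apply hcq.of_mul_right_right.mul_dvd
    · refine ⟨κ ^ 2 * y ^ 2 * ρ' + 2 * a * κ * ρ * y * s + a * q * s ^ 2 + b * s * κ * y -
        (τ * (κ * ρ * y + q * s + h * y) + κ * Δ' * r) ^ 2, ?_⟩
      linear_combination (κ ^ 2 * y ^ 2) * hρ
    · set x := κ * ρ * y + q * s with hx
      have hjt : Δ ∣ a * (x + h * y) ^ 2 - q * (τ * (x + h * y)) ^ 2 :=
        ⟨(x + h * y) ^ 2 * (4 * t * τ ^ 2 + a * ν * (1 + τ * j)), by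
          linear_combination (x + h * y) ^ 2 * (τ ^ 2 * ht - a * (1 + τ * j) * hτ)⟩
      obtain ⟨w, hw⟩ := hjt
      refine ⟨m1 * x * y + m2 * y ^ 2 + w - q * τ * (x + h * y) * κ' * r - q * Δ' * r ^ 2, ?_⟩
      linear_combination x * y * hm1 + y ^ 2 * hm2 + hw +
        (-q * τ * (x + h * y) * r * κ * Δ') * hκ +
        (- q * τ * (x + h * y) * κ' * r - q * Δ' * r ^ 2) * (-hΔ')
  obtain ⟨A1, hA1⟩ := hdvd 1 0 0
  obtain ⟨A2, hA2⟩ := hdvd 0 1 0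
  obtain ⟨A3, hA3⟩ := hdvd 0 0 1
  obtain ⟨A4, hA4⟩ := hdvd 0 1 1
  obtain ⟨A5, hA5⟩ := hdvd 1 0 1
  obtain ⟨A6, hA6⟩ := hdvd 1 1 0
  have hqΔ0 : (q : ℤ) * Δ ≠ 0 := mul_ne_zero hq0 hΔ0
  have f1 : (q : ℤ) * Δ * A1 = a * (κ * ρ) ^ 2 + b * (κ * ρ) * κ + c * κ ^ 2
      - q * (τ * (κ * ρ + h)) ^ 2 := by linear_combination -hA1
  have f2 : (q : ℤ) * Δ * A2 = a * q ^ 2 - q * (τ * q) ^ 2 := by linear_combination -hA2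
  have f3 : (q : ℤ) * Δ * A3 = - q * (κ * Δ') ^ 2 := by linear_combination -hA3
  have f4 : (q : ℤ) * Δ * (A4 - A2 - A3) = - 2 * q * (τ * q) * (κ * Δ') := by
    linear_combination -hA4 + hA2 + hA3
  have f5 : (q : ℤ) * Δ * (A5 - A1 - A3) = - 2 * q * (τ * (κ * ρ + h)) * (κ * Δ') := by
    linear_combination -hA5 + hA1 + hA3
  have f6 : (q : ℤ) * Δ * (A6 - A1 - A2) = 2 * a * κ * ρ * q + b * q * κ -
      2 * q * (τ * q) * (τ * (κ * ρ + h)) := by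
    linear_combination -hA6 + hA1 + hA2
  generalize A4 - A2 - A3 = B4 at *
  generalize A5 - A1 - A3 = B5 at *
  generalize A6 - A1 - A2 = B6 at *
  have hdisc : |4 * A1 * A2 * A3 + B4 * B5 * B6 - A1 * B4 ^ 2 - A2 * B5 ^ 2 - A3 * B6 ^ 2| = 1 := by
    have : ((q : ℤ) * Δ) ^ 3 * (4 * A1 * A2 * A3 + B4 * B5 * B6 - A1 * B4 ^ 2 - A2 * B5 ^ 2
        - A3 * B6 ^ 2) = ((q : ℤ) * Δ) ^ 3 * 1 := by
      have e : ((q : ℤ) * Δ) ^ 3 * (4 * A1 * A2 * A3 + B4 * B5 * B6 - A1 * B4 ^ 2 - A2 * B5 ^ 2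
        - A3 * B6 ^ 2) = 4 * (q * Δ * A1) * (q * Δ * A2) * (q * Δ * A3) +
          (q * Δ * B4) * (q * Δ * B5) * (q * Δ * B6) - (q * Δ * A1) * (q * Δ * B4) ^ 2 -
          (q * Δ * A2) * (q * Δ * B5) ^ 2 - (q * Δ * A3) * (q * Δ * B6) ^ 2 := by ring
      rw [e, f1, f2, f3, f4, f5, f6, hΔ']
      have e2 : b ^ 2 = κ ^ 2 * Δ' + 4 * a * c := by linear_combination hΔ'
      linear_combination (κ ^ 4 * Δ' ^ 2 * q ^ 3) * e2
    rw [mul_left_cancel₀ (pow_ne_zero 3 hqΔ0) this, abs_one]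
  obtain ⟨y, s, r, hne, hz⟩ := exists_zero_ternary_of_unimodular _ _ _ _ _ _ hdisc
  refine ⟨κ * ρ * y + q * s, κ * y, τ * (κ * ρ * y + q * s + h * y) + κ * Δ' * r, ?_, ?_⟩
  · by_contra hcon
    push Not at hcon
    obtain ⟨i1, i2, i3⟩ := hcon
    have hy : y = 0 := by simpa [hκ0] using i2
    have hs : s = 0 := by simpa [hy, hq.ne_zero] using i1
    have hr : r = 0 := by
      have : κ * Δ' ≠ 0 := by
        intro h0
        apply hΔ0
        rw [hΔ']
        linear_combination κ * h0
      simpa [hy, hs, this] using i3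
    simp [hy, hs, hr] at hne
  · linear_combination (q * Δ) * hz - y ^ 2 * f1 - s ^ 2 * f2 - r ^ 2 * f3 - s * r * f4 -
      y * r * f5 - y * s * f6

/-- The form `[a, b, c]` represents `q Z ^ 2` as soon as a value of it is congruent to a square
multiple of the prime `q` modulo four times the discriminant. -/
theorem exists_represents_prime_mul_sq_of_value {a b c : ℤ} (hΔ0 : b ^ 2 - 4 * a * c ≠ 0)
    {q : ℕ} (hq : q.Prime) (hqΔ : ¬ (q : ℤ) ∣ 4 * (b ^ 2 - 4 * a * c)) {r s : ℤ}
    (hpos : 0 < a * r ^ 2 + b * r * s + c * s ^ 2)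
    (hqF : ¬ (q : ℤ) ∣ a * r ^ 2 + b * r * s + c * s ^ 2) {k : ℤ}
    (hk : IsCoprime k (4 * (b ^ 2 - 4 * a * c)))
    (hj : (q : ℤ) * k ^ 2 ≡ a * r ^ 2 + b * r * s + c * s ^ 2 [ZMOD 4 * (b ^ 2 - 4 * a * c)]) :
    ∃ X Y Z : ℤ, (X ≠ 0 ∨ Y ≠ 0 ∨ Z ≠ 0) ∧ a * X ^ 2 + b * X * Y + c * Y ^ 2 = q * Z ^ 2 := by
  obtain ⟨r', hr⟩ := Int.gcd_dvd_left r s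
  obtain ⟨s', hs⟩ := Int.gcd_dvd_right r s
  have hg := Int.gcd_eq_gcd_ab r s
  set g : ℤ := (Int.gcd r s : ℤ) with hgdef
  set u := Int.gcdA r s
  set v := Int.gcdB r s
  have hF : a * r ^ 2 + b * r * s + c * s ^ 2 =
      (a * r' ^ 2 + b * r' * s' + c * s' ^ 2) * g ^ 2 := by rw [hr, hs]; ring
  have hg0 : g ≠ 0 := by
    intro h0
    rw [hF, h0] at hpos
    simp at hpos
  have huv : r' * u + s' * v = 1 := by
    apply mul_left_cancel₀ hg0
    linear_combination -hg - u * hr - v * hs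
  rw [hF] at hpos hqF hj
  have hdisc : (-2 * a * r' * v + b * (r' * u - s' * v) + 2 * c * s' * u) ^ 2 -
      4 * (a * r' ^ 2 + b * r' * s' + c * s' ^ 2) * (a * v ^ 2 - b * u * v + c * u ^ 2) =
      b ^ 2 - 4 * a * c := by
    have : (-2 * a * r' * v + b * (r' * u - s' * v) + 2 * c * s' * u) ^ 2 -
      4 * (a * r' ^ 2 + b * r' * s' + c * s' ^ 2) * (a * v ^ 2 - b * u * v + c * u ^ 2) =
      (b ^ 2 - 4 * a * c) * (r' * u + s' * v) ^ 2 := by ring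
    rw [this, huv]; ring
  have hapos : 0 < a * r' ^ 2 + b * r' * s' + c * s' ^ 2 :=
    pos_of_mul_pos_left hpos (sq_nonneg g)
  obtain ⟨l, m, hlm⟩ := hk
  obtain ⟨t, ht⟩ := hj.dvd
  obtain ⟨X, Y, Z, hne, h⟩ := exists_represents_prime_mul_sq (q := q) (j := g * l) hapos
    (by rwa [hdisc]) hq (by rwa [hdisc]) (fun h ↦ hqF (h.mul_right _)) (by
      rw [hdisc, Int.modEq_iff_dvd]
      refine ⟨t * l ^ 2 - q * m * (1 + l * k), ?_⟩
      linear_combination l ^ 2 * ht + q * (1 + l * k) * hlm)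
  refine ⟨r' * X - v * Y, s' * X + u * Y, Z, ?_, by rw [← h]; ring⟩
  by_contra hcon
  push Not at hcon
  obtain ⟨i1, i2, i3⟩ := hcon
  have hX : X = 0 := by linear_combination u * i1 + v * i2 - X * huv
  have hY : Y = 0 := by linear_combination r' * i2 - s' * i1 - Y * huv
  simp [hX, hY, i3] at hne

section CRT

variable {M : Type*} [AddCommGroup M]

/-- Chinese remainder theorem for conditions on a vector that only depend on the vector modulo
a prime. -/
theorem exists_forall_prime_of_local (P : ℕ → M → Prop)
    (hP : ∀ p x y, P p x → P p (x + (p : ℤ) • y)) (m : ℤ) (x : M) {n : ℤ} (hn : n ≠ 0)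
    (h : ∀ p : ℕ, p.Prime → (p : ℤ) ∣ n → ¬ (p : ℤ) ∣ m → ∃ x, P p x) :
    ∃ y : M, ∀ p : ℕ, p.Prime → (p : ℤ) ∣ n → ¬ (p : ℤ) ∣ m → P p (x + m • y) := by
  suffices H : ∀ S : Finset ℕ, (∀ p ∈ S, p.Prime ∧ (p : ℤ) ∣ n) →
      ∃ y : M, ∀ p ∈ S, ¬ (p : ℤ) ∣ m → P p (x + m • y) by
    obtain ⟨y, hy⟩ := H n.natAbs.primeFactors (fun p hp ↦
      ⟨Nat.prime_of_mem_primeFactors hp, Int.natCast_dvd.2 (Nat.dvd_of_mem_primeFactors hp)⟩)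
    exact ⟨y, fun p hp hpn ↦ hy p (Nat.mem_primeFactors.2
      ⟨hp, Int.natCast_dvd.1 hpn, Int.natAbs_ne_zero.2 hn⟩)⟩
  intro S
  induction S using Finset.induction_on with
  | empty => exact fun _ ↦ ⟨0, by simp⟩
  | insert p S hpS ih =>
    intro hS
    obtain ⟨y, hy⟩ := ih fun q hq ↦ hS q (Finset.mem_insert_of_mem hq)
    obtain ⟨hp, hpn⟩ := hS p (Finset.mem_insert_self _ _)
    by_cases hpm : (p : ℤ) ∣ m
    · refine ⟨y, fun q hq hqm ↦ ?_⟩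
      rcases Finset.mem_insert.1 hq with rfl | hq
      · exact absurd hpm hqm
      · exact hy q hq hqm
    obtain ⟨z, hz⟩ := h p hp hpn hpm
    have hcop : IsCoprime (p : ℤ) (m * ∏ q ∈ S, (q : ℤ)) := by
      refine (isCoprime_of_prime_not_dvd hp hpm).mul_right (IsCoprime.prod_right fun q hq ↦ ?_)
      have hq' := (hS q (Finset.mem_insert_of_mem hq)).1
      refine Int.isCoprime_iff_gcd_eq_one.2 ((Nat.coprime_primes hp hq').2 ?_)
      rintro rfl
      exact hpS hq
    obtain ⟨v, u, huv⟩ := hcop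
    refine ⟨y + (u * ∏ q ∈ S, (q : ℤ)) • (z - (x + m • y)), fun q hq hqm ↦ ?_⟩
    have e : x + m • (y + (u * ∏ q ∈ S, (q : ℤ)) • (z - (x + m • y))) =
        x + m • y + (u * (m * ∏ q ∈ S, (q : ℤ))) • (z - (x + m • y)) := by module
    rw [e]
    rcases Finset.mem_insert.1 hq with rfl | hq
    · have : u * (m * ∏ q ∈ S, (q : ℤ)) = 1 - v * q := by linear_combination huv
      rw [this]
      convert hP q z (-(v • (z - (x + m • y)))) hz using 1
      module
    · obtain ⟨c, hc⟩ := Finset.dvd_prod_of_mem (fun q : ℕ ↦ (q : ℤ)) hq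
      convert hP q _ ((u * m * c) • (z - (x + m • y))) (hy q hq hqm) using 1
      rw [hc]
      module

/-- A vector may be divided, modulo a submodule, until it is primitive modulo all primes. -/
theorem exists_saturated (S : Submodule ℤ M) (f : M → ℤ) (hf₁ : ∀ y, ∀ s ∈ S, f (s + y) = f y)
    (hf₂ : ∀ (k : ℤ) y, f (k • y) = k ^ 2 * f y) (y : M) (hy : f y ≠ 0) :
    ∃ (z : M) (k : ℤ), ∃ s ∈ S, k ≠ 0 ∧ y = s + k • z ∧
      ∀ p : ℕ, p.Prime → ∀ s ∈ S, ∀ w, s + z ≠ (p : ℤ) • w := by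
  induction hn : (f y).natAbs using Nat.strong_induction_on generalizing y with
  | _ n ih =>
  by_cases hgood : ∀ p : ℕ, p.Prime → ∀ s ∈ S, ∀ w, s + y ≠ (p : ℤ) • w
  · exact ⟨y, 1, 0, S.zero_mem, one_ne_zero, by simp, hgood⟩
  push Not at hgood
  obtain ⟨p, hp, s, hs, w, hw⟩ := hgood
  have hfw : f y = p ^ 2 * f w := by rw [← hf₂, ← hw, hf₁ y s hs]
  have hw0 : f w ≠ 0 := by
    rintro h0
    exact hy (by rw [hfw, h0, mul_zero])
  have hlt : (f w).natAbs < n := by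
    rw [← hn, hfw, Int.natAbs_mul, Int.natAbs_pow, Int.natAbs_natCast]
    have h1 : 0 < (f w).natAbs := Int.natAbs_pos.2 hw0
    have h2 : 1 < p ^ 2 := Nat.one_lt_pow two_ne_zero hp.one_lt
    nlinarith
  obtain ⟨z, k, s', hs', hk, hz, hz'⟩ := ih _ hlt w hw0 rfl
  refine ⟨z, p * k, -s + (p : ℤ) • s', S.add_mem (S.neg_mem hs) (S.smul_mem _ hs'),
    mul_ne_zero (by exact_mod_cast hp.ne_zero) hk, ?_, hz'⟩
  have : y = -s + (p : ℤ) • w := by rw [← hw]; abel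
  rw [this, hz]
  module

end CRT

section Quadratic

variable {M : Type*} [AddCommGroup M] (Q : QuadraticForm ℤ M)

theorem polarBilin_self (x : M) : Q.polarBilin x x = 2 * Q x := by
  simp [QuadraticMap.polarBilin, QuadraticMap.polar_self]

theorem polarBilin_comm (x y : M) : Q.polarBilin x y = Q.polarBilin y x := by
  simp [QuadraticMap.polarBilin, QuadraticMap.polar_comm]

theorem map_add_eq (x y : M) : Q (x + y) = Q x + Q y + Q.polarBilin x y := by
  simp [QuadraticMap.polarBilin, QuadraticMap.map_add]

theorem map_smul_eq (k : ℤ) (x : M) : Q (k • x) = k ^ 2 * Q x := by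
  rw [QuadraticMap.map_smul, smul_eq_mul, sq]

theorem map_sub_eq (x y : M) : Q (x - y) = Q x + Q y - Q.polarBilin x y := by
  rw [sub_eq_add_neg, map_add_eq, QuadraticMap.map_neg, map_neg]
  ring

/-- The rank of the polar form modulo every prime exceeds `k`. -/
def RankGT (k : ℕ) : Prop :=
  ∀ p : ℕ, p.Prime → ∀ ℓ : Fin k → (M →ₗ[ℤ] ℤ),
    ∃ m, (∀ i, (p : ℤ) ∣ ℓ i m) ∧ ∃ y, ¬ (p : ℤ) ∣ Q.polarBilin m y

theorem exists_zero_ternary_zmod (p : ℕ) [Fact p.Prime] (a b c d e f : ZMod p) :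
    ∃ x y z : ZMod p, (x ≠ 0 ∨ y ≠ 0 ∨ z ≠ 0) ∧
      a * x ^ 2 + b * y ^ 2 + c * z ^ 2 + d * y * z + e * x * z + f * x * y = 0 := by
  classical
  let F : MvPolynomial (Fin 3) (ZMod p) :=
    .C a * .X 0 ^ 2 + .C b * .X 1 ^ 2 + .C c * .X 2 ^ 2 + .C d * (.X 1 * .X 2) +
      .C e * (.X 0 * .X 2) + .C f * (.X 0 * .X 1)
  have h1 : ∀ (t : ZMod p) (i : Fin 3),
      (MvPolynomial.C t * MvPolynomial.X i ^ 2 : MvPolynomial (Fin 3) (ZMod p)).totalDegree ≤ 2 :=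
    fun t i ↦ (MvPolynomial.totalDegree_mul _ _).trans (by simp)
  have h2 : ∀ (t : ZMod p) (i j : Fin 3),
      (MvPolynomial.C t * (MvPolynomial.X i * MvPolynomial.X j) :
        MvPolynomial (Fin 3) (ZMod p)).totalDegree ≤ 2 := by
    intro t i j
    refine (MvPolynomial.totalDegree_mul _ _).trans ?_
    have := MvPolynomial.totalDegree_mul (MvPolynomial.X i : MvPolynomial (Fin 3) (ZMod p))
      (MvPolynomial.X j)
    simp at this ⊢
    exact this
  have hdeg : F.totalDegree < Fintype.card (Fin 3) := by
    have hadd : ∀ f g : MvPolynomial (Fin 3) (ZMod p), f.totalDegree ≤ 2 → g.totalDegree ≤ 2 →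
      (f + g).totalDegree ≤ 2 := fun f g hf hg ↦
        (MvPolynomial.totalDegree_add f g).trans (max_le hf hg)
    have : F.totalDegree ≤ 2 := hadd _ _ (hadd _ _ (hadd _ _ (hadd _ _ (hadd _ _ (h1 _ _) (h1 _ _))
      (h1 _ _)) (h2 _ _ _)) (h2 _ _ _)) (h2 _ _ _)
    simp; omega
  have hdvd := char_dvd_card_solutions p hdeg
  have h0 : MvPolynomial.eval (0 : Fin 3 → ZMod p) F = 0 := by simp [F]
  have hcard : 1 < Fintype.card { x : Fin 3 → ZMod p // MvPolynomial.eval x F = 0 } := by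
    have hpos : 0 < Fintype.card { x : Fin 3 → ZMod p // MvPolynomial.eval x F = 0 } :=
      Fintype.card_pos_iff.2 ⟨⟨0, h0⟩⟩
    exact (Fact.out : p.Prime).one_lt.trans_le (Nat.le_of_dvd hpos hdvd)
  obtain ⟨⟨x, hx⟩, hne⟩ := Fintype.exists_ne_of_one_lt_card hcard ⟨0, h0⟩
  refine ⟨x 0, x 1, x 2, ?_, by rw [← hx]; simp [F]; ring⟩
  by_contra hcon
  push Not at hcon
  apply hne
  ext i
  fin_cases i <;> simp [hcon]

end Quadratic

section Local

variable {M : Type*} [AddCommGroup M] {Q : QuadraticForm ℤ M}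

theorem dvd_iff_zmod {p : ℕ} {a : ℤ} : (p : ℤ) ∣ a ↔ (a : ZMod p) = 0 :=
  (ZMod.intCast_zmod_eq_zero_iff_dvd a p).symm

theorem RankGT.exists_isotropic_mod (hr : RankGT Q 2) {p : ℕ} (hp : p.Prime) :
    ∃ z, (p : ℤ) ∣ Q z ∧ ∃ y, ¬ (p : ℤ) ∣ Q.polarBilin z y := by
  have := Fact.mk hp
  obtain ⟨v₁, -, y₁, h₁⟩ := hr p hp ![0, 0]
  obtain ⟨v₂, h₂, y₂, h₂'⟩ := hr p hp ![Q.polarBilin y₁, 0]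
  obtain ⟨v₃, h₃, y₃, h₃'⟩ := hr p hp ![Q.polarBilin y₁, Q.polarBilin y₂]
  have h21 := h₂ 0
  have h31 := h₃ 0
  have h32 := h₃ 1
  simp only [Fin.isValue, Matrix.cons_val_zero, Matrix.cons_val_one, Matrix.cons_val_fin_one,
    polarBilin_comm Q y₁, polarBilin_comm Q y₂, dvd_iff_zmod] at h21 h31 h32 h₁ h₂' h₃'
  obtain ⟨a, b, c, hne, h⟩ := exists_zero_ternary_zmod p (Q v₁ : ZMod p) (Q v₂) (Q v₃)
    (Q.polarBilin v₂ v₃) (Q.polarBilin v₁ v₃) (Q.polarBilin v₁ v₂)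
  obtain ⟨a, rfl⟩ := ZMod.intCast_surjective a
  obtain ⟨b, rfl⟩ := ZMod.intCast_surjective b
  obtain ⟨c, rfl⟩ := ZMod.intCast_surjective c
  refine ⟨a • v₁ + b • v₂ + c • v₃, ?_, ?_⟩
  · rw [dvd_iff_zmod, ← h]
    simp only [map_add_eq, map_add, LinearMap.add_apply, map_smul, LinearMap.smul_apply,
      smul_eq_mul, map_smul_eq]
    push_cast
    ring
  · by_contra! hcon
    simp only [map_add, LinearMap.add_apply, map_smul, LinearMap.smul_apply, smul_eq_mul,
      dvd_iff_zmod] at hcon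
    have e1 := hcon y₁
    have e2 := hcon y₂
    have e3 := hcon y₃
    push_cast at e1 e2 e3
    rw [h21, h31] at e1
    simp only [mul_zero, add_zero, mul_eq_zero, h₁, or_false] at e1
    rw [h32, e1] at e2
    simp only [mul_zero, zero_mul, zero_add, add_zero, mul_eq_zero, h₂', or_false] at e2
    rw [e1, e2] at e3
    simp only [zero_mul, zero_add, mul_eq_zero, h₃', or_false] at e3
    simp [e1, e2, e3] at hne

theorem RankGT.exists_hyperbolic_mod (hr : RankGT Q 2) {p : ℕ} (hp : p.Prime) :
    ∃ z y, (Q z : ZMod p) = 0 ∧ (Q y : ZMod p) = 0 ∧ (Q.polarBilin z y : ZMod p) = 1 := by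
  have := Fact.mk hp
  obtain ⟨z, hz, y, hy⟩ := hr.exists_isotropic_mod hp
  rw [dvd_iff_zmod] at hz hy
  obtain ⟨u, hu⟩ := ZMod.intCast_surjective ((Q.polarBilin z y : ZMod p)⁻¹)
  have hu' : (u : ZMod p) * (Q.polarBilin z y : ZMod p) = 1 := by
    rw [hu]; exact inv_mul_cancel₀ hy
  refine ⟨z, u • y - (u ^ 2 * Q y) • z, hz, ?_, ?_⟩
  · simp only [map_sub_eq, map_smul, LinearMap.smul_apply, smul_eq_mul, map_smul_eq,
      polarBilin_comm Q y z]
    push_cast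
    linear_combination ((u : ZMod p) ^ 2 * Q y) ^ 2 * hz - (u : ZMod p) ^ 2 * Q y * hu'
  · simp only [map_sub, map_smul, smul_eq_mul, polarBilin_self]
    push_cast
    linear_combination hu' - 2 * ((u : ZMod p) ^ 2 * Q y) * hz

theorem RankGT.exists_orthogonal_mod (hr : RankGT Q 2) {p : ℕ} (hp : p.Prime) {z y : M}
    (hz : (Q z : ZMod p) = 0) (hy : (Q y : ZMod p) = 0)
    (hzy : (Q.polarBilin z y : ZMod p) = 1) :
    ∃ m, (Q.polarBilin z m : ZMod p) = 0 ∧ (Q.polarBilin y m : ZMod p) = 0 ∧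
      (Q m : ZMod p) ≠ 0 := by
  have := Fact.mk hp
  by_contra! hcon
  obtain ⟨m, hm, w, hw⟩ := hr p hp ![Q.polarBilin z, Q.polarBilin y]
  have hm0 := hm 0
  have hm1 := hm 1
  simp only [Fin.isValue, Matrix.cons_val_zero, Matrix.cons_val_one, Matrix.cons_val_fin_one,
    dvd_iff_zmod] at hm0 hm1 hw
  apply hw
  set w' := w - Q.polarBilin y w • z - Q.polarBilin z w • y with hw'
  have hzw' : (Q.polarBilin z w' : ZMod p) = 0 := by
    simp only [hw', map_sub, map_smul, smul_eq_mul, polarBilin_self]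
    push_cast
    linear_combination - 2 * (Q.polarBilin y w : ZMod p) * hz - (Q.polarBilin z w : ZMod p) * hzy
  have hyw' : (Q.polarBilin y w' : ZMod p) = 0 := by
    simp only [hw', map_sub, map_smul, smul_eq_mul, polarBilin_self, polarBilin_comm Q y z]
    push_cast
    linear_combination - 2 * (Q.polarBilin z w : ZMod p) * hy - (Q.polarBilin y w : ZMod p) * hzy
  have h1 := hcon m hm0 hm1
  have h2 := hcon w' hzw' hyw'
  have h3 := hcon (m + w') (by rw [map_add, Int.cast_add, hm0, hzw', add_zero])
    (by rw [map_add, Int.cast_add, hm1, hyw', add_zero])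
  rw [map_add_eq] at h3
  have h4 : (Q.polarBilin m w' : ZMod p) = Q.polarBilin m w := by
    simp only [hw', map_sub, map_smul, smul_eq_mul, polarBilin_comm Q m z, polarBilin_comm Q m y]
    push_cast
    rw [hm0, hm1]
    ring
  push_cast at h3
  rw [← h4]
  linear_combination h3 - h1 - h2

theorem RankGT.exists_isotropic_mod_of_functional (hr : RankGT Q 2) {p : ℕ} (hp : p.Prime)
    (φ : M →ₗ[ℤ] ℤ) {m : M} (hm : ¬ (p : ℤ) ∣ φ m) :
    ∃ z, (p : ℤ) ∣ Q z ∧ ¬ (p : ℤ) ∣ φ z ∧ ∃ y, ¬ (p : ℤ) ∣ Q.polarBilin z y := by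
  have := Fact.mk hp
  by_contra! hcon
  obtain ⟨z, y, hz, hy, hzy⟩ := hr.exists_hyperbolic_mod hp
  have key : ∀ t : M, (Q t : ZMod p) = 0 → ∀ s, (Q.polarBilin t s : ZMod p) = 1 →
      (φ t : ZMod p) = 0 := by
    intro t ht s hs
    by_contra hφ
    have := hcon t (dvd_iff_zmod.2 ht) (fun h ↦ hφ (dvd_iff_zmod.1 h)) s
    rw [dvd_iff_zmod, hs] at this
    exact one_ne_zero this
  have hφz := key z hz y hzy
  have hφy := key y hy z (by rw [polarBilin_comm, hzy])
  set w := m - Q.polarBilin y m • z - Q.polarBilin z m • y with hw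
  have hzw : (Q.polarBilin z w : ZMod p) = 0 := by
    simp only [hw, map_sub, map_smul, smul_eq_mul, polarBilin_self]
    push_cast
    linear_combination - 2 * (Q.polarBilin y m : ZMod p) * hz - (Q.polarBilin z m : ZMod p) * hzy
  have hyw : (Q.polarBilin y w : ZMod p) = 0 := by
    simp only [hw, map_sub, map_smul, smul_eq_mul, polarBilin_self, polarBilin_comm Q y z]
    push_cast
    linear_combination - 2 * (Q.polarBilin z m : ZMod p) * hy - (Q.polarBilin y m : ZMod p) * hzy
  have hφw := key (z - Q w • y + w) (by
      simp only [map_add_eq, map_sub_eq, map_sub, LinearMap.sub_apply, map_smul,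
        LinearMap.smul_apply, smul_eq_mul, map_smul_eq]
      push_cast
      linear_combination hz + (Q w : ZMod p) ^ 2 * hy - (Q w : ZMod p) * hzy + hzw -
        (Q w : ZMod p) * hyw) y (by
      simp only [map_add, map_sub, LinearMap.sub_apply, LinearMap.add_apply, map_smul,
        LinearMap.smul_apply, smul_eq_mul, polarBilin_self, polarBilin_comm Q w y]
      push_cast
      linear_combination hzy - 2 * (Q w : ZMod p) * hy + hyw)
  apply hm
  rw [dvd_iff_zmod]
  have e : φ m = φ (z - Q w • y + w) - φ z + Q w * φ y + Q.polarBilin y m * φ z +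
      Q.polarBilin z m * φ y := by
    rw [hw]
    simp only [map_add, map_sub, map_smul, smul_eq_mul]
    ring
  rw [e]
  push_cast
  rw [hφw, hφz, hφy]
  ring

theorem exists_pow_dvd_of_dvd {p : ℕ} (hp : p.Prime) {z y : M} (hz : (p : ℤ) ∣ Q z)
    (hy : ¬ (p : ℤ) ∣ Q.polarBilin z y) (r : ℕ) :
    ∃ w, (p : ℤ) ^ r ∣ Q (z + (p : ℤ) • w) := by
  suffices H : ∀ r : ℕ, ∃ w, (p : ℤ) ^ (r + 1) ∣ Q (z + (p : ℤ) • w) by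
    obtain ⟨w, hw⟩ := H r
    exact ⟨w, (pow_dvd_pow _ r.le_succ).trans hw⟩
  intro r
  induction r with
  | zero => exact ⟨0, by simpa using hz⟩
  | succ r ih =>
    obtain ⟨w, t, ht⟩ := ih
    have hcop : IsCoprime (p : ℤ) (Q.polarBilin (z + (p : ℤ) • w) y) := by
      refine isCoprime_of_prime_not_dvd hp fun h ↦ hy ?_
      simp only [map_add, LinearMap.add_apply, map_smul, LinearMap.smul_apply, smul_eq_mul] at h
      exact (Int.dvd_add_left (Dvd.intro _ rfl)).1 h
    obtain ⟨u, v, huv⟩ := hcop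
    refine ⟨w - ((p : ℤ) ^ r * t * v) • y, ?_⟩
    have e : z + (p : ℤ) • (w - ((p : ℤ) ^ r * t * v) • y) =
        z + (p : ℤ) • w - ((p : ℤ) ^ (r + 1) * t * v) • y := by
      rw [pow_succ]
      module
    refine ⟨t * u + (p : ℤ) ^ r * (t * v) ^ 2 * Q y, ?_⟩
    rw [e, map_sub_eq, map_smul_eq, map_smul, smul_eq_mul, ht]
    linear_combination (-(p : ℤ) ^ (r + 1) * t) * huv

end Local

section Isotropy

variable {M : Type*} [AddCommGroup M] (Q : QuadraticForm ℤ M)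

/-- The discriminant of the restriction of a quadratic form to the span of two vectors. -/
def disc₂ (x y : M) : ℤ := Q.polarBilin x y ^ 2 - 4 * Q x * Q y

/-- Minus the half-discriminant of the restriction of a quadratic form to the span of three
vectors. -/
def disc₃ (x y v : M) : ℤ :=
  Q x * Q.polarBilin y v ^ 2 - Q.polarBilin x y * Q.polarBilin x v * Q.polarBilin y v +
    Q y * Q.polarBilin x v ^ 2 + disc₂ Q x y * Q v

variable {Q}

theorem dvd_disc₃_add_smul_iff {p : ℕ} (x y v x' y' v' : M) :
    (p : ℤ) ∣ disc₃ Q (x + (p : ℤ) • x') (y + (p : ℤ) • y') (v + (p : ℤ) • v') ↔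
      (p : ℤ) ∣ disc₃ Q x y v := by
  rw [dvd_iff_zmod, dvd_iff_zmod]
  simp only [disc₃, disc₂, map_add_eq, map_smul_eq, map_add, LinearMap.add_apply, map_smul,
    LinearMap.smul_apply, smul_eq_mul]
  push_cast
  simp

theorem disc₃_smul_left (k : ℤ) (x y v : M) : disc₃ Q (k • x) y v = k ^ 2 * disc₃ Q x y v := by
  simp only [disc₃, disc₂, map_smul_eq, map_smul, LinearMap.smul_apply, smul_eq_mul]
  ring

theorem disc₂_add_smul (i k : ℤ) (x y : M) :
    disc₂ Q x (i • x + k • y) = k ^ 2 * disc₂ Q x y := by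
  simp only [disc₂, map_add_eq, map_smul_eq, map_add, map_smul, LinearMap.smul_apply, smul_eq_mul,
    polarBilin_self]
  ring

theorem disc₃_add_smul_middle (i k : ℤ) (x y v : M) :
    disc₃ Q x (i • x + k • y) v = k ^ 2 * disc₃ Q x y v := by
  simp only [disc₃, disc₂, map_add_eq, map_smul_eq, map_add, map_smul, LinearMap.add_apply,
    LinearMap.smul_apply, smul_eq_mul, polarBilin_self]
  ring

theorem disc₃_add_smul_right (i j k : ℤ) (x y v : M) :
    disc₃ Q x y (i • x + j • y + k • v) = k ^ 2 * disc₃ Q x y v := by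
  simp only [disc₃, disc₂, map_add_eq, map_smul_eq, map_add, map_smul, LinearMap.add_apply,
    LinearMap.smul_apply, smul_eq_mul, polarBilin_self, polarBilin_comm Q y x]
  ring

theorem exists_quadratic_pos {α : ℤ} (β γ : ℤ) (hα : 0 < α) :
    ∃ t : ℤ, 0 < α * t ^ 2 + β * t + γ := by
  refine ⟨|β| + |γ| + 1, ?_⟩
  have hβ := neg_abs_le β
  have hγ := neg_abs_le γ
  have hβ' := abs_nonneg β
  have hγ' := abs_nonneg γ
  set T := |β| + |γ| + 1 with hT
  have hT0 : 0 < T := by omega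
  have h1 : T ^ 2 ≤ α * T ^ 2 := by nlinarith
  have h2 : -|β| * T ≤ β * T := by nlinarith
  have h3 : T ^ 2 + -|β| * T = T * (|γ| + 1) := by rw [hT]; ring
  have h4 : |γ| + 1 ≤ T * (|γ| + 1) := by nlinarith
  linarith

theorem RankGT.exists_disc₃_local (hr : RankGT Q 2) {p : ℕ} (hp : p.Prime) :
    ∃ x y v, ¬ (p : ℤ) ∣ disc₃ Q x y v ∧ (p = 2 → 4 ∣ Q v) := by
  have := Fact.mk hp
  obtain ⟨z, y, hz, hy, hzy⟩ := hr.exists_hyperbolic_mod hp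
  obtain ⟨m, hzm, hym, hm⟩ := hr.exists_orthogonal_mod hp hz hy hzy
  obtain ⟨w, hw⟩ := exists_pow_dvd_of_dvd hp (dvd_iff_zmod.2 hz) (y := y)
    (by rw [dvd_iff_zmod, hzy]; exact one_ne_zero) 2
  refine ⟨m, y, z + (p : ℤ) • w, ?_, ?_⟩
  · have := dvd_disc₃_add_smul_iff (Q := Q) (p := p) m y z 0 0 w
    simp only [smul_zero, add_zero] at this
    rw [this, dvd_iff_zmod]
    convert hm using 1
    simp only [disc₃, disc₂, polarBilin_comm Q m, polarBilin_comm Q y z]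
    push_cast
    rw [hz, hy, hzy, hzm, hym]
    ring_nf
  · rintro rfl
    exact_mod_cast hw

theorem RankGT.exists_disc₃_global (hr : RankGT Q 2) {d : ℤ} (hd0 : d ≠ 0) :
    ∃ x y v, 4 ∣ Q v ∧ ∀ p : ℕ, p.Prime → (p : ℤ) ∣ 4 * d → ¬ (p : ℤ) ∣ disc₃ Q x y v := by
  obtain ⟨x, y, v, h2, hv⟩ := hr.exists_disc₃_local Nat.prime_two
  obtain ⟨⟨x', y', v'⟩, h⟩ := exists_forall_prime_of_local (M := M × M × M)
    (fun p t ↦ ¬ (p : ℤ) ∣ disc₃ Q t.1 t.2.1 t.2.2)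
    (fun p t t' h ↦ (dvd_disc₃_add_smul_iff _ _ _ _ _ _).not.2 h) 4 (x, y, v) hd0
    (fun p hp _ _ ↦ by
      obtain ⟨x, y, v, h, -⟩ := hr.exists_disc₃_local hp
      exact ⟨(x, y, v), h⟩)
  refine ⟨x + (4 : ℤ) • x', y + (4 : ℤ) • y', v + (4 : ℤ) • v', ?_, ?_⟩
  · rw [map_add_eq, map_smul_eq, map_smul, smul_eq_mul]
    obtain ⟨t, ht⟩ := hv rfl
    exact ⟨t + 4 * Q v' + Q.polarBilin v v', by rw [ht]; ring⟩
  · intro p hp hpd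
    by_cases h4 : (p : ℤ) ∣ 4
    · have hp2 : p = 2 := by
        have : p ∣ 2 ^ 2 := by exact_mod_cast h4
        exact (Nat.prime_dvd_prime_iff_eq hp Nat.prime_two).1 (hp.dvd_of_dvd_pow this)
      subst hp2
      have e : ∀ a b : M, a + (4 : ℤ) • b = a + ((2 : ℕ) : ℤ) • (2 : ℤ) • b := by
        intro a b
        rw [smul_smul]
        norm_num
      rw [e, e, e, dvd_disc₃_add_smul_iff]
      exact h2
    · have := h p hp ((Nat.prime_iff_prime_int.1 hp).dvd_or_dvd hpd |>.resolve_left h4) h4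
      simpa using this

/-- A vector of positive norm, primitive modulo all primes, that is part of a triple which is
nondegenerate modulo the primes dividing `4 * d`. -/
theorem exists_first_vector (hr : RankGT Q 2) {d : ℤ} (hd0 : d ≠ 0) {X : M} (hX : 0 < Q X) :
    ∃ x y v, 4 ∣ Q v ∧ (∀ p : ℕ, p.Prime → (p : ℤ) ∣ 4 * d → ¬ (p : ℤ) ∣ disc₃ Q x y v) ∧
      0 < Q x ∧ ∀ p : ℕ, p.Prime → ∀ w, x ≠ (p : ℤ) • w := by
  obtain ⟨x, y, v, hv, h⟩ := hr.exists_disc₃_global hd0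
  have hd4 : 0 < (4 * d) ^ 2 := by positivity
  obtain ⟨t, ht⟩ := exists_quadratic_pos (4 * d * Q.polarBilin x X) (Q x) (mul_pos hd4 hX)
  have hpos : 0 < Q (x + (4 * d * t) • X) := by
    rw [map_add_eq, map_smul_eq, map_smul, smul_eq_mul]
    convert ht using 1
    ring
  obtain ⟨z, k, s, hs, hk, hz, hsat⟩ := exists_saturated (⊥ : Submodule ℤ M) Q
    (fun y s hs ↦ by rw [(Submodule.mem_bot ℤ).1 hs, zero_add]) (map_smul_eq Q) _ hpos.ne'
  rw [(Submodule.mem_bot ℤ).1 hs, zero_add] at hz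
  refine ⟨z, y, v, hv, ?_, ?_, fun p hp w ↦ by simpa using hsat p hp 0 (Submodule.zero_mem _) w⟩
  · intro p hp hpd hdvd
    apply h p hp hpd
    obtain ⟨c, hc⟩ := hpd
    have := dvd_disc₃_add_smul_iff (Q := Q) (p := p) x y v ((c * t) • X) 0 0
    simp only [smul_zero, add_zero] at this
    rw [smul_smul, ← mul_assoc, ← hc, hz,
      disc₃_smul_left] at this
    exact this.1 (hdvd.mul_left _)
  · rw [hz, map_smul_eq] at hpos
    exact pos_of_mul_pos_right hpos (sq_nonneg k)

theorem exists_disc₂_neg {x X Y : M} (hx : 0 < Q x) (hX : 0 < Q X) (hXY : disc₂ Q X Y < 0) :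
    ∃ Z, disc₂ Q x Z < 0 := by
  by_cases h : Q.polarBilin x X = 0
  · refine ⟨X, ?_⟩
    rw [disc₂, h]
    nlinarith
  · refine ⟨Q.polarBilin x Y • X - Q.polarBilin x X • Y, ?_⟩
    have e : disc₂ Q x (Q.polarBilin x Y • X - Q.polarBilin x X • Y) =
        -4 * Q x * (Q X * Q.polarBilin x Y ^ 2 - Q.polarBilin X Y * Q.polarBilin x Y *
          Q.polarBilin x X + Q Y * Q.polarBilin x X ^ 2) := by
      simp only [disc₂, map_sub_eq, map_smul_eq, map_sub, map_smul, LinearMap.smul_apply,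
        smul_eq_mul]
      ring
    rw [e]
    have h1 : 0 < 4 * Q X * (Q X * Q.polarBilin x Y ^ 2 - Q.polarBilin X Y * Q.polarBilin x Y *
          Q.polarBilin x X + Q Y * Q.polarBilin x X ^ 2) := by
      have e2 : 4 * Q X * (Q X * Q.polarBilin x Y ^ 2 - Q.polarBilin X Y * Q.polarBilin x Y *
          Q.polarBilin x X + Q Y * Q.polarBilin x X ^ 2) =
          (2 * Q X * Q.polarBilin x Y - Q.polarBilin X Y * Q.polarBilin x X) ^ 2 +
            (-disc₂ Q X Y) * Q.polarBilin x X ^ 2 := by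
        rw [disc₂]; ring
      rw [e2]
      have h3 : 0 < Q.polarBilin x X ^ 2 := by positivity
      have := mul_pos (neg_pos.2 hXY) h3
      positivity
    have h2 := pos_of_mul_pos_right h1 (by positivity)
    nlinarith [mul_pos hx h2]

theorem exists_second_vector {d : ℤ} (hd0 : d ≠ 0)
    (hd : ∀ p : ℕ, p.Prime → ¬ (p : ℤ) ∣ d → ∀ x, (∀ y, (p : ℤ) ∣ Q.polarBilin x y) →
      ∃ z, x = (p : ℤ) • z)
    {x y v : M} (h : ∀ p : ℕ, p.Prime → (p : ℤ) ∣ 4 * d → ¬ (p : ℤ) ∣ disc₃ Q x y v)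
    (hx : 0 < Q x) (hxp : ∀ p : ℕ, p.Prime → ∀ w, x ≠ (p : ℤ) • w) {Z : M}
    (hZ : disc₂ Q x Z < 0) :
    ∃ y, (∀ p : ℕ, p.Prime → (p : ℤ) ∣ 4 * d → ¬ (p : ℤ) ∣ disc₃ Q x y v) ∧
      disc₂ Q x y < 0 ∧ (∀ p : ℕ, p.Prime → ∀ (i : ℤ) w, i • x + y ≠ (p : ℤ) • w) ∧
      ∀ p : ℕ, p.Prime → (p : ℤ) ∣ disc₂ Q x y → ¬ (p : ℤ) ∣ 4 * d → ¬ (p : ℤ) ∣ Q x := by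
  obtain ⟨y', hy'⟩ := exists_forall_prime_of_local (fun p y ↦ ¬ (p : ℤ) ∣ Q.polarBilin x y)
    (fun p y y' h h' ↦ by
      rw [map_add, map_smul, smul_eq_mul] at h'
      exact h ((Int.dvd_add_left (Dvd.intro _ rfl)).1 h')) (4 * d) y hx.ne'
    (fun p hp _ hpd ↦ by
      by_contra! hcon
      obtain ⟨z, hz⟩ := hd p hp (fun h ↦ hpd (h.mul_left 4)) x hcon
      exact hxp p hp z hz)
  set y₂ := y + (4 * d) • y' with hy₂
  have hA : 0 < (4 * d * Q x) ^ 2 := by positivity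
  obtain ⟨t, ht⟩ := exists_quadratic_pos (-(4 * d * Q x) * (2 * Q.polarBilin x y₂ *
    Q.polarBilin x Z - 4 * Q x * Q.polarBilin y₂ Z)) (- disc₂ Q x y₂)
    (mul_pos hA (neg_pos.2 hZ))
  set y₃ := y₂ + (4 * d * Q x * t) • Z with hy₃
  have hneg : disc₂ Q x y₃ < 0 := by
    rw [← neg_pos]
    convert ht using 1
    simp only [disc₂, hy₃, map_add_eq, map_smul_eq, map_smul, map_add, smul_eq_mul]
    ring
  have hy₃' : y₃ = y + (4 * d) • (y' + (Q x * t) • Z) := by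
    rw [hy₃, hy₂]; module
  obtain ⟨z, k, s, hs, hk, hz, hsat⟩ := exists_saturated (Submodule.span ℤ {x}) (disc₂ Q x)
    (fun y s hs ↦ by
      obtain ⟨i, rfl⟩ := Submodule.mem_span_singleton.1 hs
      simpa using disc₂_add_smul (Q := Q) i 1 x y)
    (fun k y ↦ by simpa using disc₂_add_smul (Q := Q) 0 k x y) _ hneg.ne
  obtain ⟨i, rfl⟩ := Submodule.mem_span_singleton.1 hs
  refine ⟨z, ?_, ?_, fun p hp i w ↦
    hsat p hp (i • x) (Submodule.mem_span_singleton.2 ⟨i, rfl⟩) w, ?_⟩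
  · intro p hp hpd hdvd
    apply h p hp hpd
    obtain ⟨c, hc⟩ := hpd
    have := dvd_disc₃_add_smul_iff (Q := Q) (p := p) x y v 0 (c • (y' + (Q x * t) • Z)) 0
    simp only [smul_zero, add_zero] at this
    rw [smul_smul, ← hc, ← hy₃', hz,
      disc₃_add_smul_middle] at this
    exact this.1 (hdvd.mul_left _)
  · rw [hz, disc₂_add_smul] at hneg
    have := sq_nonneg k
    by_contra! hcon
    nlinarith
  · intro p hp hpδ hpd hpx
    have h1 := hy' p hp hpx hpd
    apply h1
    have hb : (p : ℤ) ∣ Q.polarBilin x z := by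
      rw [disc₂] at hpδ
      have : (p : ℤ) ∣ Q.polarBilin x z ^ 2 :=
        ((dvd_sub_left ((hpx.mul_left 4).mul_right _))).1 hpδ
      exact (Nat.prime_iff_prime_int.1 hp).dvd_of_dvd_pow this
    have e : y + (4 * d) • y' = i • x + k • z - (4 * d * Q x * t) • Z := by
      rw [← hz, hy₃, hy₂]; abel
    rw [← hy₂] at e
    rw [e]
    simp only [map_sub, map_add, map_smul, smul_eq_mul, polarBilin_self]
    refine dvd_sub (dvd_add ?_ (hb.mul_left _)) ?_
    · exact (hpx.mul_left 2).mul_left _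
    · exact ((hpx.mul_left (4 * d)).mul_right t).mul_right _

theorem exists_third_vector {d : ℤ} (hd0 : d ≠ 0)
    (hd : ∀ p : ℕ, p.Prime → ¬ (p : ℤ) ∣ d → ∀ x, (∀ y, (p : ℤ) ∣ Q.polarBilin x y) →
      ∃ z, x = (p : ℤ) • z)
    {x y v : M} (h : ∀ p : ℕ, p.Prime → (p : ℤ) ∣ 4 * d → ¬ (p : ℤ) ∣ disc₃ Q x y v)
    (hv : 4 ∣ Q v) (hδ : disc₂ Q x y < 0)
    (hsat : ∀ p : ℕ, p.Prime → ∀ (i : ℤ) w, i • x + y ≠ (p : ℤ) • w)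
    (hx : ∀ p : ℕ, p.Prime → (p : ℤ) ∣ disc₂ Q x y → ¬ (p : ℤ) ∣ 4 * d → ¬ (p : ℤ) ∣ Q x)
    {V : M} (hV : Q V < 0) :
    ∃ v, 4 ∣ Q v ∧ Q v < 0 ∧ ∀ p : ℕ, p.Prime → (p : ℤ) ∣ 4 * d * disc₂ Q x y →
      ¬ (p : ℤ) ∣ disc₃ Q x y v := by
  obtain ⟨v', hv'⟩ := exists_forall_prime_of_local (fun p v ↦ ¬ (p : ℤ) ∣ disc₃ Q x y v)
    (fun p v v' h ↦ by
      have := dvd_disc₃_add_smul_iff (Q := Q) (p := p) x y v 0 0 v'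
      simp only [smul_zero, add_zero] at this
      exact this.not.2 h) (4 * d) v hδ.ne
    (fun p hp hpδ hpd ↦ by
      have hpx := hx p hp hpδ hpd
      have := Fact.mk hp
      by_contra! hcon
      obtain ⟨z, hz⟩ := hd p hp (fun h ↦ hpd (h.mul_left 4))
        ((2 * Q x) • y - Q.polarBilin x y • x) (fun v ↦ by
          have h1 := hcon v
          rw [dvd_iff_zmod] at h1 hpδ ⊢
          simp only [disc₃] at h1
          have e : (Q.polarBilin ((2 * Q x) • y - Q.polarBilin x y • x) v) ^ 2 =
              4 * Q x * (Q x * Q.polarBilin y v ^ 2 - Q.polarBilin x y * Q.polarBilin x v *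
                Q.polarBilin y v + Q y * Q.polarBilin x v ^ 2) +
                disc₂ Q x y * Q.polarBilin x v ^ 2 := by
            simp only [disc₂, map_sub, map_smul, LinearMap.sub_apply, LinearMap.smul_apply,
              smul_eq_mul]
            ring
          rw [← sq_eq_zero_iff, ← Int.cast_pow, e]
          push_cast at h1 ⊢
          rw [hpδ] at h1 ⊢
          linear_combination 4 * (Q x : ZMod p) * h1)
      have h2 : ¬ (p : ℤ) ∣ 2 := fun h ↦ hpd (h.trans ⟨2 * d, by ring⟩)
      obtain ⟨a, b, hab⟩ := (isCoprime_of_prime_not_dvd hp h2).mul_right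
        (isCoprime_of_prime_not_dvd hp hpx)
      apply hsat p hp (-(b * Q.polarBilin x y)) (b • z + a • y)
      have : y = (a * p + b * (2 * Q x)) • y := by rw [hab, one_smul]
      calc _ = -(b * Q.polarBilin x y) • x + (a * p + b * (2 * Q x)) • y := by rw [← this]
        _ = b • ((2 * Q x) • y - Q.polarBilin x y • x) + (a * p) • y := by module
        _ = _ := by rw [hz]; module)
  set v₂ := v + (4 * d) • v' with hv₂
  set δ := disc₂ Q x y with hδdef
  have hA : 0 < (4 * d * δ) ^ 2 := by
    have := hδ.ne
    positivity
  obtain ⟨t, ht⟩ := exists_quadratic_pos (-(4 * d * δ) * Q.polarBilin v₂ V) (- Q v₂)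
    (mul_pos hA (neg_pos.2 hV))
  refine ⟨v₂ + (4 * d * δ * t) • V, ?_, ?_, ?_⟩
  · obtain ⟨c, hc⟩ := hv
    rw [hv₂]
    simp only [map_add_eq, map_smul_eq, map_add, map_smul, LinearMap.add_apply,
      LinearMap.smul_apply, smul_eq_mul, hc]
    refine ⟨c + 4 * d ^ 2 * Q v' + d * Q.polarBilin v v' + 4 * (d * δ * t) ^ 2 * Q V +
      d * δ * t * (Q.polarBilin v V + 4 * d * Q.polarBilin v' V), by ring⟩
  · rw [← neg_pos]
    convert ht using 1
    simp only [map_add_eq, map_smul_eq, map_smul, smul_eq_mul]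
    ring
  · intro p hp hpd
    by_cases hp4 : (p : ℤ) ∣ 4 * d
    · obtain ⟨c, hc⟩ := hp4
      have := dvd_disc₃_add_smul_iff (Q := Q) (p := p) x y v 0 0 (c • (v' + (δ * t) • V))
      simp only [smul_zero, add_zero] at this
      rw [smul_smul, ← hc] at this
      have e : v₂ + (4 * d * δ * t) • V = v + (4 * d) • (v' + (δ * t) • V) := by
        rw [hv₂]; module
      rw [e, this]
      exact h p hp ⟨c, hc⟩
    · have hpδ := ((Nat.prime_iff_prime_int.1 hp).dvd_or_dvd hpd).resolve_left hp4
      have h1 := hv' p hp hpδ hp4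
      obtain ⟨c, hc⟩ := hpδ
      have := dvd_disc₃_add_smul_iff (Q := Q) (p := p) x y v₂ 0 0 ((4 * d * c * t) • V)
      simp only [smul_zero, add_zero] at this
      rw [smul_smul] at this
      have e : (p : ℤ) * (4 * d * c * t) = 4 * d * δ * t := by rw [hc]; ring
      rw [e] at this
      rwa [this]

end Isotropy

section Isotropy

variable {M : Type*} [AddCommGroup M] {Q : QuadraticForm ℤ M}

theorem isCoprime_of_forall_prime {a b : ℤ}
    (h : ∀ p : ℕ, p.Prime → (p : ℤ) ∣ a → ¬ (p : ℤ) ∣ b) : IsCoprime a b := by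
  rw [Int.isCoprime_iff_gcd_eq_one]
  by_contra hg
  obtain ⟨p, hp, hpg⟩ := Nat.exists_prime_and_dvd hg
  have hpg' : (p : ℤ) ∣ (Int.gcd a b : ℤ) := by exact_mod_cast hpg
  exact h p hp (hpg'.trans (Int.gcd_dvd_left ..)) (hpg'.trans (Int.gcd_dvd_right ..))

variable (Q) in
/-- A vector orthogonal to `x` and `y`, congruent to a multiple of `v` modulo their span. -/
def orthProj (x y v : M) : M :=
  disc₂ Q x y • v + (2 * Q y * Q.polarBilin x v - Q.polarBilin x y * Q.polarBilin y v) • x +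
    (2 * Q x * Q.polarBilin y v - Q.polarBilin x y * Q.polarBilin x v) • y

theorem polarBilin_orthProj_left (x y v : M) : Q.polarBilin x (orthProj Q x y v) = 0 := by
  simp only [orthProj, disc₂, map_add, map_smul, smul_eq_mul, polarBilin_self]
  ring

theorem polarBilin_orthProj_right (x y v : M) : Q.polarBilin y (orthProj Q x y v) = 0 := by
  simp only [orthProj, disc₂, map_add, map_smul, smul_eq_mul, polarBilin_self,
    polarBilin_comm Q y x]
  ring

theorem polarBilin_orthProj_self (x y v : M) :
    Q.polarBilin (orthProj Q x y v) v = 2 * disc₃ Q x y v := by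
  simp only [orthProj, disc₂, disc₃, map_add, map_smul, smul_eq_mul, polarBilin_self,
    LinearMap.add_apply, LinearMap.smul_apply]
  ring

theorem polarBilin_orthProj_orthProj (x y v u : M) :
    Q.polarBilin (orthProj Q x y v) (orthProj Q x y u) =
      disc₂ Q x y * Q.polarBilin (orthProj Q x y v) u := by
  have hx := polarBilin_orthProj_left (Q := Q) x y v
  have hy := polarBilin_orthProj_right (Q := Q) x y v
  generalize orthProj Q x y v = w at *
  rw [orthProj, map_add, map_add, map_smul, map_smul, map_smul, polarBilin_comm Q w x,
    polarBilin_comm Q w y, hx, hy]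
  simp only [smul_eq_mul]
  ring

theorem map_orthProj (x y v : M) : Q (orthProj Q x y v) = disc₂ Q x y * disc₃ Q x y v := by
  have h := polarBilin_orthProj_orthProj (Q := Q) x y v v
  rw [polarBilin_orthProj_self, polarBilin_self] at h
  linarith

theorem map_combination (x y : M) (s t : ℤ) :
    Q (s • x + t • y) = Q x * s ^ 2 + Q.polarBilin x y * s * t + Q y * t ^ 2 := by
  simp only [map_add_eq, map_smul_eq, map_smul, LinearMap.smul_apply, smul_eq_mul]
  ring

/-- A definite binary form vanishes only at the origin. -/
theorem eq_zero_of_binary_eq_zero {a b c s t : ℤ} (ha : 0 < a) (h : b ^ 2 - 4 * a * c < 0)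
    (h0 : a * s ^ 2 + b * s * t + c * t ^ 2 = 0) : s = 0 ∧ t = 0 := by
  have h1 : (2 * a * s + b * t) ^ 2 + -(b ^ 2 - 4 * a * c) * t ^ 2 = 0 := by
    linear_combination 4 * a * h0
  have ht : t = 0 := by
    by_contra ht
    have : 0 < t ^ 2 := by positivity
    nlinarith [sq_nonneg (2 * a * s + b * t)]
  subst ht
  refine ⟨?_, rfl⟩
  simpa [ha.ne'] using h0

theorem exists_isotropic_of_disc₃_eq_one {x y v : M} (hx : 0 < Q x) (hδ : disc₂ Q x y < 0)
    (h : disc₃ Q x y v = 1) : ∃ w, w ≠ 0 ∧ Q w = 0 := by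
  obtain ⟨r, s, t, hne, h0⟩ := exists_zero_ternary_of_unimodular (Q x) (Q y) (Q v)
    (Q.polarBilin y v) (Q.polarBilin x v) (Q.polarBilin x y) (by
      rw [abs_eq one_pos.le]
      right
      rw [← h, disc₃, disc₂]
      ring)
  have hQ : Q (r • x + s • y + t • v) = 0 := by
    rw [← h0]
    simp only [map_add_eq, map_smul_eq, map_smul, LinearMap.smul_apply, smul_eq_mul,
      map_add, LinearMap.add_apply]
    ring
  refine ⟨_, fun hw ↦ ?_, hQ⟩
  have ht : t = 0 := by
    have := congr_arg (Q.polarBilin (orthProj Q x y v)) hw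
    simp only [map_add, map_smul, polarBilin_orthProj_self, map_zero,
      polarBilin_comm Q (orthProj Q x y v) x, polarBilin_comm Q (orthProj Q x y v) y,
      polarBilin_orthProj_left, polarBilin_orthProj_right, h, smul_eq_mul] at this
    omega
  rw [hw] at hQ
  have := eq_zero_of_binary_eq_zero hx hδ (s := r) (t := s) (by
    rw [← map_combination, ← hQ, ← hw, ht]
    simp)
  simp [this, ht] at hne

theorem exists_isotropic_of_represents {x y : M} (hx : 0 < Q x) (hδ : disc₂ Q x y < 0) {v u : M}
    {q : ℤ} (hq : q ≠ 0)
    (hG : Q.polarBilin (orthProj Q x y v) u ^ 2 - 4 * disc₃ Q x y v * disc₃ Q x y u ≠ 0)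
    {X Y Z : ℤ} (h : X ≠ 0 ∨ Y ≠ 0 ∨ Z ≠ 0)
    (hXY : Q x * X ^ 2 + Q.polarBilin x y * X * Y + Q y * Y ^ 2 = q * Z ^ 2)
    {X' Y' Z' : ℤ} (h' : X' ≠ 0 ∨ Y' ≠ 0 ∨ Z' ≠ 0)
    (hXY' : disc₃ Q x y v * X' ^ 2 + Q.polarBilin (orthProj Q x y v) u * X' * Y' +
      disc₃ Q x y u * Y' ^ 2 = q * Z' ^ 2) :
    ∃ w, w ≠ 0 ∧ Q w = 0 := by
  set v' := orthProj Q x y v with hv'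
  set u' := orthProj Q x y u with hu'
  have hvu : Q.polarBilin v' u' = disc₂ Q x y * Q.polarBilin v' u :=
    polarBilin_orthProj_orthProj x y v u
  set w₁ := (Q.polarBilin x y * X + 2 * Q y * Y) • x + (-(2 * Q x * X + Q.polarBilin x y * Y)) • y
    with hw₁
  set w₂ := X' • v' + Y' • u' with hw₂
  have hQ₁ : Q w₁ = - disc₂ Q x y * (q * Z ^ 2) := by
    rw [hw₁, map_combination, ← hXY, disc₂]
    ring
  have hQ₂ : Q w₂ = disc₂ Q x y * (q * Z' ^ 2) := by
    rw [hw₂, map_combination, ← hXY', hvu, hv', hu', map_orthProj, map_orthProj]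
    ring
  have h12 : Q.polarBilin w₁ w₂ = 0 := by
    simp only [hw₁, hw₂, hv', hu', map_add, map_smul, LinearMap.add_apply, LinearMap.smul_apply,
      polarBilin_orthProj_left, polarBilin_orthProj_right, smul_zero, add_zero]
  have hZ : Z ≠ 0 := by
    rintro rfl
    have := eq_zero_of_binary_eq_zero hx hδ (s := X) (t := Y) (by rw [hXY]; ring)
    simp [this] at h
  refine ⟨Z' • w₁ + Z • w₂, fun hw ↦ ?_, ?_⟩
  · have hZ' : Z' = 0 := by
      have := congr_arg (Q.polarBilin w₁) hw
      rw [map_add, map_smul, map_smul, h12, polarBilin_self, hQ₁, map_zero] at this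
      simp only [smul_eq_mul, mul_zero, add_zero] at this
      have hne : 2 * (- disc₂ Q x y * (q * Z ^ 2)) ≠ 0 :=
        mul_ne_zero two_ne_zero (mul_ne_zero (neg_ne_zero.2 hδ.ne)
          (mul_ne_zero hq (pow_ne_zero 2 hZ)))
      exact (mul_eq_zero.1 this).resolve_right hne
    rw [hZ', zero_smul, zero_add] at hw
    have hvv : Q v' = disc₂ Q x y * disc₃ Q x y v := map_orthProj x y v
    have huu : Q u' = disc₂ Q x y * disc₃ Q x y u := map_orthProj x y u
    have e1 := congr_arg (Q.polarBilin v') hw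
    have e2 := congr_arg (Q.polarBilin u') hw
    simp only [hw₂, map_smul, map_add, polarBilin_self, polarBilin_comm Q u' v', hvu, map_zero,
      hvv, huu, smul_eq_mul] at e1 e2
    have hne : Z * disc₂ Q x y ≠ 0 := mul_ne_zero hZ hδ.ne
    have e1' : X' * (2 * disc₃ Q x y v) + Y' * Q.polarBilin v' u = 0 := by
      apply mul_left_cancel₀ hne
      linear_combination e1
    have e2' : X' * Q.polarBilin v' u + Y' * (2 * disc₃ Q x y u) = 0 := by
      apply mul_left_cancel₀ hne
      linear_combination e2
    have hX' : X' = 0 := by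
      apply mul_left_cancel₀ hG
      linear_combination Q.polarBilin v' u * e2' - 2 * disc₃ Q x y u * e1'
    have hY' : Y' = 0 := by
      apply mul_left_cancel₀ hG
      linear_combination Q.polarBilin v' u * e1' - 2 * disc₃ Q x y v * e2'
    simp [hX', hY', hZ'] at h'
  · rw [map_combination, h12, hQ₁, hQ₂]
    ring

theorem exists_prime_congr {a m : ℤ} (hm : m ≠ 0) (h : IsCoprime a m) (n : ℕ) :
    ∃ q : ℕ, q.Prime ∧ n < q ∧ (q : ℤ) ≡ a [ZMOD m] := by
  obtain ⟨q, hq, hqp, hqa⟩ := Nat.forall_exists_prime_gt_and_zmodEq n (q := m.natAbs) (a := a)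
    (Int.natAbs_ne_zero.2 hm) (by
      rw [Int.isCoprime_iff_gcd_eq_one] at h ⊢
      rwa [Int.gcd, Int.natAbs_natCast])
  refine ⟨q, hqp, hq, ?_⟩
  rw [Int.modEq_iff_dvd] at hqa ⊢
  exact Int.natAbs_dvd.1 hqa

/-- An indefinite even lattice whose rank is large compared to the number of generators of its
discriminant group is isotropic. -/
theorem exists_isotropic (hr : RankGT Q 2) {d : ℤ} (hd0 : d ≠ 0)
    (hd : ∀ p : ℕ, p.Prime → ¬ (p : ℤ) ∣ d → ∀ x, (∀ y, (p : ℤ) ∣ Q.polarBilin x y) →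
      ∃ z, x = (p : ℤ) • z)
    {X Y V : M} (hX : 0 < Q X) (hXY : disc₂ Q X Y < 0) (hV : Q V < 0) :
    ∃ w, w ≠ 0 ∧ Q w = 0 := by
  obtain ⟨x, y₀, v₀, hv₀, hdisc₀, hx, hxp⟩ := exists_first_vector hr hd0 hX
  obtain ⟨Z, hZ⟩ := exists_disc₂_neg hx hX hXY
  obtain ⟨y, hdisc₁, hδ, hsat, hxδ⟩ := exists_second_vector hd0 hd hdisc₀ hx hxp hZ
  obtain ⟨v₁, hv4, hvneg, hdisc₂⟩ := exists_third_vector hd0 hd hdisc₁ hv₀ hδ hsat hxδ hV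
  set δ := disc₂ Q x y with hδdef
  set a₀ := Q x * Q.polarBilin y v₁ ^ 2 + Q.polarBilin x y * Q.polarBilin y v₁ *
    (-Q.polarBilin x v₁) + Q y * (-Q.polarBilin x v₁) ^ 2 with ha₀
  have hc₁ : disc₃ Q x y v₁ = a₀ + δ * Q v₁ := by rw [disc₃, ha₀]; ring
  have hodd : ¬ (2 : ℤ) ∣ disc₃ Q x y v₁ := by
    exact_mod_cast hdisc₂ 2 Nat.prime_two ⟨2 * d * δ, by push_cast; ring⟩
  have ha₀pos : 0 < a₀ := by
    have h1 : 0 ≤ 4 * Q x * a₀ := by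
      have : 4 * Q x * a₀ = (2 * Q x * Q.polarBilin y v₁ -
          Q.polarBilin x y * Q.polarBilin x v₁) ^ 2 + (-δ) * Q.polarBilin x v₁ ^ 2 := by
        rw [ha₀, hδdef, disc₂]; ring
      rw [this]
      have := neg_pos.2 hδ
      positivity
    have h2 : 0 ≤ a₀ := nonneg_of_mul_nonneg_right h1 (by positivity)
    refine lt_of_le_of_ne h2 fun h3 ↦ hodd ?_
    rw [hc₁, ← h3, zero_add]
    exact ((show (2 : ℤ) ∣ 4 by norm_num).trans hv4).mul_left δ
  have hc₁pos : 0 < disc₃ Q x y v₁ := by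
    rw [hc₁]
    have := mul_pos_of_neg_of_neg hδ hvneg
    positivity
  obtain ⟨v, k, s, hs, hk, hv, hvsat⟩ := exists_saturated (Submodule.span ℤ {x, y}) (disc₃ Q x y)
    (fun v s hs ↦ by
      obtain ⟨i, j, rfl⟩ := Submodule.mem_span_pair.1 hs
      simpa using disc₃_add_smul_right (Q := Q) i j 1 x y v)
    (fun k v ↦ by simpa using disc₃_add_smul_right (Q := Q) 0 0 k x y v) _ hc₁pos.ne'
  obtain ⟨i, j, rfl⟩ := Submodule.mem_span_pair.1 hs
  have hck : disc₃ Q x y v₁ = k ^ 2 * disc₃ Q x y v := by rw [hv, disc₃_add_smul_right]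
  have hcpos : 0 < disc₃ Q x y v := by
    rw [hck] at hc₁pos
    exact pos_of_mul_pos_right hc₁pos (sq_nonneg k)
  set c := disc₃ Q x y v with hc
  have hcop₁ : IsCoprime (disc₃ Q x y v₁) (4 * d * δ) :=
    isCoprime_of_forall_prime fun p hp h1 h2 ↦ hdisc₂ p hp h2 h1
  have hcopc : IsCoprime c (4 * d * δ) := by
    rw [hck] at hcop₁
    exact hcop₁.of_mul_left_right
  have hcopk : IsCoprime k (4 * δ) := by
    rw [hck] at hcop₁
    have := (IsCoprime.pow_left_iff two_pos).1 hcop₁.of_mul_left_left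
    exact this.of_isCoprime_of_dvd_right ⟨d, by ring⟩
  rcases eq_or_ne c 1 with hc1 | hc1
  · exact exists_isotropic_of_disc₃_eq_one hx hδ hc1
  obtain ⟨u, hu⟩ := exists_forall_prime_of_local
    (fun p u ↦ ¬ (p : ℤ) ∣ Q.polarBilin (orthProj Q x y v) u)
    (fun p y y' h h' ↦ by
      rw [map_add, map_smul, smul_eq_mul] at h'
      exact h ((Int.dvd_add_left (Dvd.intro _ rfl)).1 h')) 1 0 hcpos.ne'
    (fun p hp hpc _ ↦ by
      have hpd : ¬ (p : ℤ) ∣ 4 * d * δ := fun h ↦ by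
        have := (Nat.prime_iff_prime_int.1 hp).not_isUnit
        exact this (hcopc.isUnit_of_dvd' hpc h)
      by_contra! hcon
      obtain ⟨z, hz⟩ := hd p hp (fun h ↦ hpd ((h.mul_left 4).mul_right _)) _ hcon
      obtain ⟨α, β, h⟩ := isCoprime_of_prime_not_dvd hp
        (fun h ↦ hpd (h.mul_left (4 * d)) : ¬ (p : ℤ) ∣ δ)
      rw [orthProj] at hz
      refine hvsat p hp ((β * (2 * Q y * Q.polarBilin x v - Q.polarBilin x y *
        Q.polarBilin y v)) • x + (β * (2 * Q x * Q.polarBilin y v - Q.polarBilin x y *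
        Q.polarBilin x v)) • y) (Submodule.mem_span_pair.2 ⟨_, _, rfl⟩) (β • z + α • v) ?_
      rw [smul_add, smul_comm, ← hz]
      generalize 2 * Q y * Q.polarBilin x v - Q.polarBilin x y * Q.polarBilin y v = A
      generalize 2 * Q x * Q.polarBilin y v - Q.polarBilin x y * Q.polarBilin x v = B
      have e : v = (α * p + β * δ) • v := by rw [h, one_smul]
      calc _ = (β * A) • x + (β * B) • y + (α * p + β * δ) • v := by rw [← e]
        _ = _ := by rw [hδdef]; module)
  simp only [zero_add, one_smul] at hu
  set g := Q.polarBilin (orthProj Q x y v) u with hg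
  set D := g ^ 2 - 4 * c * disc₃ Q x y u with hD
  have hcop1 : ∀ p : ℕ, p.Prime → (p : ℤ) ∣ c → ¬ (p : ℤ) ∣ D := by
    intro p hp hpc hpD
    have h1 : ¬ (p : ℤ) ∣ 1 := fun h ↦ (Nat.prime_iff_prime_int.1 hp).not_isUnit
      (isUnit_of_dvd_one h)
    refine hu p hp hpc h1 ((Nat.prime_iff_prime_int.1 hp).dvd_of_dvd_pow (n := 2) ?_)
    exact (dvd_sub_left ((hpc.mul_left 4).mul_right _)).1 hpD
  have hD0 : D ≠ 0 := by
    obtain ⟨p, hp, hpc⟩ := Nat.exists_prime_and_dvd (n := c.natAbs) (by omega)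
    exact fun h ↦ hcop1 p hp (Int.natCast_dvd.2 hpc) (h ▸ dvd_zero _)
  have hcopm : IsCoprime c (4 * δ * D) :=
    (hcopc.of_isCoprime_of_dvd_right ⟨d, by ring⟩).mul_right
      (isCoprime_of_forall_prime hcop1)
  have hm0 : 4 * δ * D ≠ 0 := by
    have := hδ.ne
    positivity
  obtain ⟨q, hq, hqlarge, hqc⟩ := exists_prime_congr hm0 hcopm
    ((4 * δ).natAbs + (4 * D).natAbs + c.natAbs + a₀.natAbs)
  have hlarge : ∀ t : ℤ, t ≠ 0 → t.natAbs < q → ¬ (q : ℤ) ∣ t := fun t ht hlt h ↦ by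
    have := Nat.le_of_dvd (Int.natAbs_pos.2 ht) (Int.natCast_dvd.1 h)
    omega
  obtain ⟨X₁, Y₁, Z₁, hne₁, h₁⟩ := exists_represents_prime_mul_sq_of_value (a := Q x)
    (b := Q.polarBilin x y) (c := Q y) (q := q) (r := Q.polarBilin y v₁)
    (s := -Q.polarBilin x v₁) (k := k) hδ.ne hq
    (hlarge _ (mul_ne_zero four_ne_zero hδ.ne) (by rw [← disc₂, ← hδdef]; omega)) ha₀pos
    (hlarge _ ha₀pos.ne' (by omega)) hcopk (by
      rw [← ha₀, ← disc₂, ← hδdef]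
      obtain ⟨t, ht⟩ := hqc.dvd
      obtain ⟨e, he⟩ := hv4
      rw [Int.modEq_iff_dvd]
      refine ⟨t * D * k ^ 2 - e, ?_⟩
      linear_combination k ^ 2 * ht + hck - hc₁ - δ * he)
  obtain ⟨X₂, Y₂, Z₂, hne₂, h₂⟩ := exists_represents_prime_mul_sq_of_value (a := c)
    (b := g) (c := disc₃ Q x y u) (q := q) (r := 1) (s := 0) (k := 1) hD0 hq
    (hlarge _ (mul_ne_zero four_ne_zero hD0) (by rw [← hD]; omega)) (by simpa using hcpos)
    (by simpa using hlarge c hcpos.ne' (by omega)) isCoprime_one_left (by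
      obtain ⟨t, ht⟩ := hqc.dvd
      rw [← hD, Int.modEq_iff_dvd]
      exact ⟨t * δ, by linear_combination ht⟩)
  exact exists_isotropic_of_represents hx hδ (by exact_mod_cast hq.ne_zero) hD0 hne₁ h₁ hne₂ h₂

end Isotropy

section Hyperbolic

variable {M : Type*} [AddCommGroup M] {Q : QuadraticForm ℤ M}

theorem exists_apply_eq_one (ψ : M →ₗ[ℤ] ℤ)
    (h : ∀ p : ℕ, p.Prime → ∃ y, ¬ (p : ℤ) ∣ ψ y) : ∃ y, ψ y = 1 := by
  obtain ⟨g, hg⟩ := (IsPrincipalIdealRing.principal (LinearMap.range ψ : Ideal ℤ)).principal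
  have hmem : ∀ y, g ∣ ψ y := fun y ↦ by
    have : ψ y ∈ LinearMap.range ψ := ⟨y, rfl⟩
    rw [hg] at this
    exact Ideal.mem_span_singleton.1 this
  have hg1 : g.natAbs = 1 := by
    by_contra hne
    obtain ⟨p, hp, hpg⟩ := Nat.exists_prime_and_dvd hne
    obtain ⟨y, hy⟩ := h p hp
    exact hy ((Int.natCast_dvd.2 hpg).trans (hmem y))
  have : (1 : ℤ) ∈ LinearMap.range ψ := by
    rw [hg]
    exact Ideal.mem_span_singleton.2 (Int.natAbs_dvd_natAbs.1 (by simp [hg1]))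
  exact this

theorem exists_eq_smul_primitive (ψ : M →ₗ[ℤ] ℤ) (h : ψ ≠ 0) :
    ∃ (D : ℤ) (φ : M →ₗ[ℤ] ℤ), D ≠ 0 ∧ ψ = D • φ ∧ ∃ y, φ y = 1 := by
  obtain ⟨g, hg⟩ := (IsPrincipalIdealRing.principal (LinearMap.range ψ : Ideal ℤ)).principal
  have hmem : ∀ y, g ∣ ψ y := fun y ↦ by
    have : ψ y ∈ LinearMap.range ψ := ⟨y, rfl⟩
    rw [hg] at this
    exact Ideal.mem_span_singleton.1 this
  have hg0 : g ≠ 0 := by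
    rintro rfl
    exact h (LinearMap.ext fun y ↦ zero_dvd_iff.1 (hmem y))
  choose φ hφ using hmem
  refine ⟨g, ⟨⟨φ, fun x y ↦ ?_⟩, fun k x ↦ ?_⟩, hg0, LinearMap.ext hφ, ?_⟩
  · apply mul_left_cancel₀ hg0
    rw [mul_add, ← hφ, ← hφ, ← hφ, map_add]
  · apply mul_left_cancel₀ hg0
    change g * φ (k • x) = g * (k * φ x)
    rw [← hφ, map_smul, hφ, smul_eq_mul]
    ring
  · have : g ∈ LinearMap.range ψ := by
      rw [hg]
      exact Ideal.mem_span_singleton_self g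
    obtain ⟨y, hy⟩ := this
    refine ⟨y, mul_left_cancel₀ hg0 ?_⟩
    change g * φ y = g * 1
    rw [← hφ, hy, mul_one]

theorem RankGT.exists_dvd_map (hr : RankGT Q 2) (φ : M →ₗ[ℤ] ℤ) {m : M} (hm : φ m = 1) (D : ℕ) :
    D ≠ 0 → ∃ z, (D : ℤ) ∣ Q z ∧ ∀ p : ℕ, p.Prime → p ∣ D → ¬ (p : ℤ) ∣ φ z ∧
      ∃ y, ¬ (p : ℤ) ∣ Q.polarBilin z y := by
  induction D using Nat.recOnPosPrimePosCoprime with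
  | zero => exact fun h ↦ absurd rfl h
  | one => exact fun _ ↦ ⟨0, by simp, fun p hp h ↦ absurd (Nat.dvd_one.1 h) hp.ne_one⟩
  | prime_pow p n hp hn =>
    intro _
    obtain ⟨z, hz, hφ, y, hy⟩ := hr.exists_isotropic_mod_of_functional hp φ (m := m) (by
      rw [hm]
      exact fun h ↦ (Nat.prime_iff_prime_int.1 hp).not_isUnit (isUnit_of_dvd_one h))
    obtain ⟨w, hw⟩ := exists_pow_dvd_of_dvd hp hz hy n
    refine ⟨z + (p : ℤ) • w, by exact_mod_cast hw, fun q hq hqp ↦ ?_⟩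
    obtain rfl := (Nat.prime_dvd_prime_iff_eq hq hp).1 (hq.dvd_of_dvd_pow hqp)
    refine ⟨fun h ↦ hφ ?_, y, fun h ↦ hy ?_⟩
    · rw [map_add, map_smul, smul_eq_mul] at h
      exact (Int.dvd_add_left (Dvd.intro _ rfl)).1 h
    · rw [map_add, map_smul, LinearMap.add_apply, LinearMap.smul_apply, smul_eq_mul] at h
      exact (Int.dvd_add_left (Dvd.intro _ rfl)).1 h
  | coprime a b ha hb hab iha ihb =>
    intro _
    obtain ⟨z₁, hz₁, h₁⟩ := iha (by omega)
    obtain ⟨z₂, hz₂, h₂⟩ := ihb (by omega)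
    obtain ⟨u, v, huv⟩ := Nat.isCoprime_iff_coprime.2 hab
    have e₁ : (v * b) • z₁ + (u * a) • z₂ = z₁ + (a : ℤ) • (u • (z₂ - z₁)) := by
      rw [show v * b = 1 - u * a by linear_combination huv]
      module
    have e₂ : (v * b) • z₁ + (u * a) • z₂ = z₂ + (b : ℤ) • (v • (z₁ - z₂)) := by
      rw [show u * a = 1 - v * b by linear_combination huv]
      module
    have key : ∀ (c : ℤ) (x y : M), c ∣ Q x → c ∣ Q (x + c • y) := fun c x y h ↦ by
      rw [map_add_eq, map_smul_eq, map_smul, smul_eq_mul]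
      exact dvd_add (dvd_add h (Dvd.intro _ (by ring : c * (c * Q y) = _))) (Dvd.intro _ rfl)
    have key₂ : ∀ (ψ : M →ₗ[ℤ] ℤ) (c p : ℤ) (x y : M), p ∣ c → p ∣ ψ (x + c • y) → p ∣ ψ x :=
      fun ψ c p x y hc h ↦ by
        rw [map_add, map_smul, smul_eq_mul] at h
        exact (Int.dvd_add_left (hc.mul_right _)).1 h
    refine ⟨(v * b) • z₁ + (u * a) • z₂, ?_, fun p hp hpab ↦ ?_⟩
    · push_cast
      refine IsCoprime.mul_dvd ⟨u, v, huv⟩ ?_ ?_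
      · rw [e₁]
        exact key _ _ _ hz₁
      · rw [e₂]
        exact key _ _ _ hz₂
    · rcases hp.dvd_mul.1 hpab with h | h
      · obtain ⟨hφ, y, hy⟩ := h₁ p hp h
        rw [e₁]
        refine ⟨fun h' ↦ hφ (key₂ φ _ _ _ _ (by exact_mod_cast h) h'), y, fun h' ↦ hy ?_⟩
        rw [polarBilin_comm] at h' ⊢
        exact key₂ _ _ _ _ _ (by exact_mod_cast h) h'
      · obtain ⟨hφ, y, hy⟩ := h₂ p hp h
        rw [e₂]
        refine ⟨fun h' ↦ hφ (key₂ φ _ _ _ _ (by exact_mod_cast h) h'), y, fun h' ↦ hy ?_⟩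
        rw [polarBilin_comm] at h' ⊢
        exact key₂ _ _ _ _ _ (by exact_mod_cast h) h'

/-- An isotropic vector outside the radical of the polar form can be replaced by one contained in
a hyperbolic plane. -/
theorem exists_hyperbolic_pair (hr : RankGT Q 2) {w : M} (hw : Q w = 0)
    (hw' : Q.polarBilin w ≠ 0) : ∃ e f, Q e = 0 ∧ Q f = 0 ∧ Q.polarBilin e f = 1 := by
  obtain ⟨D, φ, hD, hφ, m, hm⟩ := exists_eq_smul_primitive _ hw'
  have hwφ : ∀ x, Q.polarBilin w x = D * φ x := fun x ↦ by
    rw [hφ, LinearMap.smul_apply, smul_eq_mul]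
  obtain ⟨z₀, hz₀, hz₀'⟩ := hr.exists_dvd_map φ hm D.natAbs (Int.natAbs_ne_zero.2 hD)
  rw [Int.natAbs_dvd] at hz₀
  obtain ⟨b, a, hab⟩ : IsCoprime D (φ z₀) := isCoprime_of_forall_prime fun p hp hpD ↦
    (hz₀' p hp (Int.natCast_dvd.1 hpD)).1
  set z := a • z₀ + (b * D) • m with hz
  have hφz : φ z = 1 := by
    rw [hz, map_add, map_smul, map_smul, hm, smul_eq_mul, smul_eq_mul]
    linear_combination hab
  obtain ⟨k, hk⟩ : D ∣ Q z := by
    obtain ⟨t, ht⟩ := hz₀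
    rw [hz, map_combination, ht]
    exact ⟨t * a ^ 2 + Q.polarBilin z₀ m * a * b + Q m * b ^ 2 * D, by ring⟩
  have he : Q (z - k • w) = 0 := by
    rw [map_sub_eq, map_smul_eq, hw, map_smul, polarBilin_comm, hwφ, hφz, hk, smul_eq_mul]
    ring
  obtain ⟨f, hf⟩ := exists_apply_eq_one (Q.polarBilin (z - k • w)) fun p hp ↦ by
    by_cases hpD : (p : ℤ) ∣ D
    · obtain ⟨-, y, hy⟩ := hz₀' p hp (Int.natCast_dvd.1 hpD)
      have hpa : ¬ (p : ℤ) ∣ a := fun hpa ↦ (Nat.prime_iff_prime_int.1 hp).not_isUnit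
        (isUnit_of_dvd_one (hab ▸ dvd_add (hpD.mul_left b) (hpa.mul_right _)))
      refine ⟨y, fun h ↦ ?_⟩
      obtain ⟨t, rfl⟩ := hpD
      have : Q.polarBilin (z - k • w) y = a * Q.polarBilin z₀ y +
          p * (b * t * Q.polarBilin m y - k * t * φ y) := by
        simp only [hz, map_sub, map_add, map_smul, LinearMap.add_apply, LinearMap.sub_apply,
          LinearMap.smul_apply, smul_eq_mul, hwφ]
        ring
      rw [this, Int.dvd_add_left (Dvd.intro _ rfl)] at h
      exact ((Nat.prime_iff_prime_int.1 hp).dvd_or_dvd h).elim hpa hy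
    · refine ⟨w, ?_⟩
      have : Q.polarBilin (z - k • w) w = D := by
        rw [polarBilin_comm, map_sub, map_smul, polarBilin_self, hw, hwφ, hφz]
        simp
      rwa [this]
  refine ⟨z - k • w, f - Q f • (z - k • w), he, ?_, ?_⟩
  · rw [map_sub_eq, map_smul_eq, he, map_smul, polarBilin_comm, hf, smul_eq_mul]
    ring
  · rw [map_sub, map_smul, polarBilin_self, he, hf]
    simp

end Hyperbolic

section Splitting

variable {M : Type*} [AddCommGroup M] {Q : QuadraticForm ℤ M}

variable (Q) in
/-- The form is positive on the nonzero vectors of some sublattice of rank `k`. -/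
def PosOnRank (k : ℕ) : Prop :=
  ∃ X : Fin k → M, ∀ c : Fin k → ℤ, c ≠ 0 → 0 < Q (∑ i, c i • X i)

theorem PosOnRank.descend {M' : Type*} [AddCommGroup M'] {Q' : QuadraticForm ℤ M'} {k : ℕ}
    (h : PosOnRank Q (k + 1)) (ψ : M →ₗ[ℤ] ℤ) (π : M →ₗ[ℤ] M')
    (hπ : ∀ x, ψ x = 0 → Q' (π x) = Q x) : PosOnRank Q' k := by
  obtain ⟨X, hX⟩ := h
  obtain ⟨j, b, hb, hj⟩ : ∃ (j : Fin (k + 1)) (b : ℤ), b ≠ 0 ∧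
      ∀ i, b * ψ (X i) = ψ (X i) * ψ (X j) := by
    by_cases h : ∀ i, ψ (X i) = 0
    · exact ⟨0, 1, one_ne_zero, fun i ↦ by simp [h]⟩
    · push Not at h
      obtain ⟨j, hj⟩ := h
      exact ⟨j, ψ (X j), hj, fun i ↦ mul_comm _ _⟩
  refine ⟨fun i ↦ π (b • X (j.succAbove i) - ψ (X (j.succAbove i)) • X j), fun c hc ↦ ?_⟩
  have e : ∑ i, c i • (b • X (j.succAbove i) - ψ (X (j.succAbove i)) • X j) =
      ∑ i, (j.insertNth (-∑ i, c i * ψ (X (j.succAbove i))) (b • c) : Fin (k + 1) → ℤ) i • X i := by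
    rw [Fin.sum_univ_succAbove _ j]
    simp only [Fin.insertNth_apply_same, Fin.insertNth_apply_succAbove, smul_sub,
      Finset.sum_sub_distrib, neg_smul, Finset.sum_smul, Pi.smul_apply, smul_eq_mul, ← mul_smul,
      mul_comm b]
    abel
  simp only [← map_smul]
  rw [← map_sum, hπ, e]
  · refine hX _ fun h0 ↦ hc (funext fun i ↦ ?_)
    have := congr_fun h0 (j.succAbove i)
    simpa [hb] using this
  · rw [map_sum]
    refine Finset.sum_eq_zero fun i _ ↦ ?_
    rw [map_smul, map_sub, map_smul, map_smul, smul_eq_mul, smul_eq_mul, smul_eq_mul, hj, sub_self,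
      mul_zero]

theorem PosOnRank.mono {j k : ℕ} (hjk : j ≤ k) (h : PosOnRank Q k) : PosOnRank Q j := by
  induction k, hjk using Nat.le_induction with
  | base => exact h
  | succ k _ ih => exact ih (h.descend 0 LinearMap.id fun _ _ ↦ rfl)

theorem PosOnRank.exists_pos (h : PosOnRank Q 1) : ∃ x, 0 < Q x := by
  obtain ⟨X, hX⟩ := h
  exact ⟨_, hX 1 one_ne_zero⟩

theorem PosOnRank.exists_disc₂_neg (h : PosOnRank Q 2) : ∃ x y, 0 < Q x ∧ disc₂ Q x y < 0 := by
  obtain ⟨X, hX⟩ := h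
  have h₁ : 0 < Q (X 0) := by simpa using hX ![1, 0] (by simp)
  refine ⟨X 0, X 1, h₁, ?_⟩
  have h₂ := hX ![-Q.polarBilin (X 0) (X 1), 2 * Q (X 0)] fun h ↦ by
    have := congr_fun h 1
    simp [h₁.ne'] at this
  rw [Fin.sum_univ_two] at h₂
  simp only [Matrix.cons_val_zero, Matrix.cons_val_one, map_combination] at h₂
  have : 0 < Q (X 0) * -disc₂ Q (X 0) (X 1) := by
    rw [disc₂]
    linarith
  exact neg_pos.1 (pos_of_mul_pos_right this h₁.le)

theorem RankGT.mono {j k : ℕ} (hjk : j ≤ k) (h : RankGT Q k) : RankGT Q j := fun p hp ℓ ↦ by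
  obtain ⟨m, hm, hy⟩ := h p hp fun i ↦ if hi : i < j then ℓ ⟨i, hi⟩ else 0
  refine ⟨m, fun i ↦ ?_, hy⟩
  simpa using hm (Fin.castLE hjk i)

variable (Q) in
/-- The conditions on a quadratic form that allow to split off hyperbolic planes. -/
structure IsLargeIndefinite (d : ℤ) (k s t : ℕ) : Prop where
  separating : ∀ x, (∀ y, Q.polarBilin x y = 0) → x = 0
  unimodular_away : ∀ p : ℕ, p.Prime → ¬ (p : ℤ) ∣ d → ∀ x, (∀ y, (p : ℤ) ∣ Q.polarBilin x y) →
    ∃ z, x = (p : ℤ) • z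
  rank_mod : RankGT Q k
  pos : PosOnRank Q s
  neg : PosOnRank (-Q) t

theorem IsLargeIndefinite.exists_hyperbolic_pair {d : ℤ} (hd : d ≠ 0) {k s t : ℕ}
    (h : IsLargeIndefinite Q d (k + 2) (s + 2) (t + 1)) :
    ∃ e f, Q e = 0 ∧ Q f = 0 ∧ Q.polarBilin e f = 1 := by
  have hr : RankGT Q 2 := h.rank_mod.mono (by omega)
  obtain ⟨X, Y, hX, hXY⟩ := (h.pos.mono (show 2 ≤ s + 2 by omega)).exists_disc₂_neg
  obtain ⟨V, hV⟩ := (h.neg.mono (show 1 ≤ t + 1 by omega)).exists_pos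
  obtain ⟨w, hw, hQw⟩ := exists_isotropic hr hd h.unimodular_away hX hXY
    (show Q V < 0 by simpa using hV)
  exact Refl.exists_hyperbolic_pair hr hQw fun h0 ↦ hw (h.separating w fun y ↦ by rw [h0]; rfl)

/-- The orthogonal complement of a hyperbolic plane. -/
def hyperbolicCompl (Q : QuadraticForm ℤ M) (e f : M) : Submodule ℤ M :=
  LinearMap.ker (Q.polarBilin e) ⊓ LinearMap.ker (Q.polarBilin f)

theorem mem_hyperbolicCompl {e f x : M} :
    x ∈ hyperbolicCompl Q e f ↔ Q.polarBilin e x = 0 ∧ Q.polarBilin f x = 0 := Iff.rfl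

/-- The orthogonal projection to the complement of a hyperbolic plane. -/
def hyperbolicProj {e f : M} (he : Q e = 0) (hf : Q f = 0) (hef : Q.polarBilin e f = 1) :
    M →ₗ[ℤ] hyperbolicCompl Q e f :=
  (LinearMap.id - (Q.polarBilin f).smulRight e - (Q.polarBilin e).smulRight f).codRestrict _
    fun x ↦ by
      have hfe : Q.polarBilin f e = 1 := by rw [polarBilin_comm, hef]
      rw [mem_hyperbolicCompl]
      simp only [LinearMap.sub_apply, LinearMap.id_apply, LinearMap.smulRight_apply, map_sub,
        map_smul, polarBilin_self, he, hf, hef, hfe, smul_eq_mul]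
      constructor <;> ring

variable {e f : M} (he : Q e = 0) (hf : Q f = 0) (hef : Q.polarBilin e f = 1)

theorem coe_hyperbolicProj (x : M) : (hyperbolicProj he hf hef x : M) =
    x - Q.polarBilin f x • e - Q.polarBilin e x • f := rfl

theorem polarBilin_hyperbolicProj (x : hyperbolicCompl Q e f) (y : M) :
    Q.polarBilin x (hyperbolicProj he hf hef y) = Q.polarBilin x y := by
  obtain ⟨hx₁, hx₂⟩ := mem_hyperbolicCompl.1 x.2
  rw [coe_hyperbolicProj, map_sub, map_sub, map_smul, map_smul, polarBilin_comm Q x e,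
    polarBilin_comm Q x f, hx₁, hx₂]
  simp

theorem hyperbolicProj_coe (x : hyperbolicCompl Q e f) : hyperbolicProj he hf hef x = x := by
  obtain ⟨hx₁, hx₂⟩ := mem_hyperbolicCompl.1 x.2
  ext
  rw [coe_hyperbolicProj, hx₁, hx₂]
  simp

theorem map_hyperbolicProj (x : M) :
    Q (hyperbolicProj he hf hef x) = Q x - Q.polarBilin e x * Q.polarBilin f x := by
  rw [coe_hyperbolicProj]
  simp only [map_sub_eq, map_smul_eq, map_smul, LinearMap.sub_apply, map_sub,
    LinearMap.smul_apply, smul_eq_mul, he, hf, hef, polarBilin_comm Q x]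
  ring

/-- Splitting of a lattice into a hyperbolic plane and its complement. -/
def hyperbolicEquiv : M ≃ₗ[ℤ] (Fin 2 → ℤ) × hyperbolicCompl Q e f where
  toFun x := (![Q.polarBilin f x, Q.polarBilin e x], hyperbolicProj he hf hef x)
  map_add' x y := by ext i <;> [fin_cases i <;> simp; simp]
  map_smul' k x := by ext i <;> [fin_cases i <;> simp; simp]
  invFun c := c.1 0 • e + c.1 1 • f + c.2
  left_inv x := by
    simp only [coe_hyperbolicProj, Matrix.cons_val_zero, Matrix.cons_val_one]
    abel
  right_inv := by
    rintro ⟨c, x, hx⟩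
    obtain ⟨hx₁, hx₂⟩ := mem_hyperbolicCompl.1 hx
    have hfe : Q.polarBilin f e = 1 := by rw [polarBilin_comm, hef]
    have h₁ : Q.polarBilin f (c 0 • e + c 1 • f + x) = c 0 := by
      simp only [map_add, map_smul, polarBilin_self, hf, hfe, hx₂, smul_eq_mul]
      ring
    have h₂ : Q.polarBilin e (c 0 • e + c 1 • f + x) = c 1 := by
      simp only [map_add, map_smul, polarBilin_self, he, hef, hx₁, smul_eq_mul]
      ring
    refine Prod.ext (funext fun i ↦ ?_) (Subtype.ext ?_)
    · fin_cases i
      · exact h₁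
      · exact h₂
    · rw [coe_hyperbolicProj, h₁, h₂]
      dsimp only
      abel

theorem map_hyperbolicEquiv (x : M) :
    Q x = (hyperbolicEquiv he hf hef x).1 0 * (hyperbolicEquiv he hf hef x).1 1 +
      Q (hyperbolicEquiv he hf hef x).2 := by
  change _ = Q.polarBilin f x * Q.polarBilin e x + Q (hyperbolicProj he hf hef x)
  rw [map_hyperbolicProj]
  ring

theorem IsLargeIndefinite.hyperbolicCompl {e f : M} (he : Q e = 0) (hf : Q f = 0)
    (hef : Q.polarBilin e f = 1) {d : ℤ} {k s t : ℕ}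
    (h : IsLargeIndefinite Q d (k + 2) (s + 1) (t + 1)) :
    IsLargeIndefinite (Q.comp (hyperbolicCompl Q e f).subtype) d k s t where
  separating x hx := by
    ext
    refine h.separating _ fun y ↦ ?_
    rw [← polarBilin_hyperbolicProj he hf hef]
    exact hx _
  unimodular_away p hp hpd x hx := by
    obtain ⟨z, hz⟩ := h.unimodular_away p hp hpd x fun y ↦ by
      rw [← polarBilin_hyperbolicProj he hf hef]
      exact hx _
    refine ⟨hyperbolicProj he hf hef z, ?_⟩
    rw [← map_smul, ← hz, hyperbolicProj_coe]
  rank_mod p hp ℓ := by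
    obtain ⟨m, hm, y, hy⟩ := h.rank_mod p hp (Matrix.vecCons (Q.polarBilin e)
      (Matrix.vecCons (Q.polarBilin f) fun i ↦ ℓ i ∘ₗ hyperbolicProj he hf hef))
    have h₁ : (p : ℤ) ∣ Q.polarBilin e m := hm 0
    have h₂ : (p : ℤ) ∣ Q.polarBilin f m := hm 1
    refine ⟨hyperbolicProj he hf hef m, fun i ↦ hm i.succ.succ, hyperbolicProj he hf hef y,
      fun hdvd ↦ hy ?_⟩
    change (p : ℤ) ∣ Q.polarBilin (hyperbolicProj he hf hef m) (hyperbolicProj he hf hef y) at hdvd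
    rw [polarBilin_hyperbolicProj, coe_hyperbolicProj, map_sub, map_sub, LinearMap.sub_apply,
      LinearMap.sub_apply, map_smul, map_smul, LinearMap.smul_apply, LinearMap.smul_apply,
      smul_eq_mul, smul_eq_mul] at hdvd
    exact (dvd_sub_left (h₂.mul_right _)).1 ((dvd_sub_left (h₁.mul_right _)).1 hdvd)
  pos := h.pos.descend (Q.polarBilin e) (hyperbolicProj he hf hef) fun x hx ↦ by
    change Q (hyperbolicProj he hf hef x) = Q x
    rw [map_hyperbolicProj, hx]
    ring
  neg := h.neg.descend (Q.polarBilin e) (hyperbolicProj he hf hef) fun x hx ↦ by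
    change -Q (hyperbolicProj he hf hef x) = -Q x
    rw [map_hyperbolicProj, hx]
    ring

end Splitting

section GramMatrix

variable {N : ℕ}

/-- The quadratic form with a given even Gram matrix. -/
theorem exists_quadraticForm {B : Matrix (Fin N) (Fin N) ℤ} (hB : B.IsSymm)
    (heven : ∀ x, 2 ∣ x ⬝ᵥ B *ᵥ x) :
    ∃ Q : QuadraticForm ℤ (Fin N → ℤ), ∀ x y, Q.polarBilin x y = x ⬝ᵥ B *ᵥ y := by
  have hsymm : ∀ x y, x ⬝ᵥ B *ᵥ y = y ⬝ᵥ B *ᵥ x := fun x y ↦ by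
    rw [dotProduct_mulVec, ← mulVec_transpose, hB.eq, dotProduct_comm]
  have hadd : ∀ x y, (x + y) ⬝ᵥ B *ᵥ (x + y) / 2 =
      x ⬝ᵥ B *ᵥ x / 2 + y ⬝ᵥ B *ᵥ y / 2 + x ⬝ᵥ B *ᵥ y := fun x y ↦ by
    have h : (x + y) ⬝ᵥ B *ᵥ (x + y) = x ⬝ᵥ B *ᵥ x + y ⬝ᵥ B *ᵥ y + 2 * (x ⬝ᵥ B *ᵥ y) := by
      rw [mulVec_add, add_dotProduct, dotProduct_add, dotProduct_add, hsymm y x]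
      ring
    have h₁ := heven x
    have h₂ := heven y
    omega
  refine ⟨⟨fun x ↦ x ⬝ᵥ B *ᵥ x / 2, fun k x ↦ ?_, Matrix.toBilin' B, fun x y ↦ ?_⟩, fun x y ↦ ?_⟩
  · simp only [mulVec_smul, smul_dotProduct, dotProduct_smul, smul_eq_mul]
    rw [← mul_assoc, Int.mul_ediv_assoc _ (heven x)]
  · simp only [hadd, Matrix.toBilin'_apply']
  · change (x + y) ⬝ᵥ B *ᵥ (x + y) / 2 - x ⬝ᵥ B *ᵥ x / 2 - y ⬝ᵥ B *ᵥ y / 2 = _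
    rw [hadd]
    ring

theorem exists_ne_zero_of_card_lt {K : Type*} [Field K] {a b : ℕ} (h : a + b < N)
    (A : Matrix (Fin a) (Fin N) K) (C : Matrix (Fin b) (Fin N) K) :
    ∃ m ≠ 0, A *ᵥ m = 0 ∧ C *ᵥ m = 0 := by
  have hker := LinearMap.ker_ne_bot_of_finrank_lt (f := A.mulVecLin.prod C.mulVecLin)
    (by simpa using h)
  obtain ⟨m, hm, hm0⟩ := (Submodule.ne_bot_iff _).1 hker
  refine ⟨m, hm0, ?_⟩
  simpa using hm

/-- The rank of a Gram matrix modulo a prime is bounded below in terms of the number of generators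
of its cokernel. -/
theorem rankGT_of_span {B : Matrix (Fin N) (Fin N) ℤ}
    {Q : QuadraticForm ℤ (Fin N → ℤ)} (hQ : ∀ x y, Q.polarBilin x y = x ⬝ᵥ B *ᵥ y) {j k : ℕ}
    (hk : j + k < N) (f : Fin k → (Fin N → ℤ) ⧸ LinearMap.range (Matrix.toLin' B))
    (hf : Submodule.span ℤ (Set.range f) = ⊤) : RankGT Q j := by
  intro p hp ℓ
  have := Fact.mk hp
  choose g hg using fun i ↦ Submodule.Quotient.mk_surjective _ (f i)
  obtain ⟨m', hm0, hA, hC⟩ := exists_ne_zero_of_card_lt hk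
    (Matrix.of fun i s ↦ (ℓ i (Pi.single s 1) : ZMod p)) (Matrix.of fun i s ↦ (g i s : ZMod p))
  choose m hm using fun s ↦ ZMod.intCast_surjective (m' s)
  obtain rfl : (fun s ↦ (m s : ZMod p)) = m' := funext hm
  refine ⟨m, fun i ↦ ?_, ?_⟩
  · rw [dvd_iff_zmod]
    refine Eq.trans ?_ (congr_fun hA i)
    conv_lhs => rw [pi_eq_sum_univ' m, map_sum]
    simp only [map_smul, Int.cast_sum, smul_eq_mul, Int.cast_mul, mulVec, dotProduct,
      Matrix.of_apply]
    exact Finset.sum_congr rfl fun s _ ↦ mul_comm _ _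
  by_contra! hcon
  apply hm0
  have hgm : ∀ i, (p : ℤ) ∣ g i ⬝ᵥ m := fun i ↦ by
    rw [dvd_iff_zmod]
    simpa [mulVec, dotProduct] using congr_fun hC i
  let S : Submodule ℤ (Fin N → ℤ) :=
    Submodule.comap (LinearMap.flip (dotProductBilin ℤ ℤ) m) (Ideal.span {(p : ℤ)})
  have hS : ∀ v, v ∈ S ↔ (p : ℤ) ∣ v ⬝ᵥ m := fun v ↦ Ideal.mem_span_singleton
  have hrange : LinearMap.range (Matrix.toLin' B) ≤ S := by
    rintro _ ⟨v, rfl⟩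
    rw [hS, toLin'_apply, dotProduct_comm, ← hQ]
    exact hcon v
  have htop : ∀ v, v ∈ S := fun v ↦ by
    have hv : (Submodule.Quotient.mk v : (Fin N → ℤ) ⧸ LinearMap.range (Matrix.toLin' B)) ∈
        S.map (Submodule.mkQ _) := by
      have hle : Submodule.span ℤ (Set.range f) ≤ S.map (Submodule.mkQ _) :=
        Submodule.span_le.2 (by
          rintro _ ⟨i, rfl⟩
          exact ⟨g i, (hS _).2 (hgm i), hg i⟩)
      exact hle (hf ▸ Submodule.mem_top)
    obtain ⟨w, hw, hwv⟩ := hv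
    have := (Submodule.Quotient.eq _).1 hwv
    simpa using S.sub_mem hw (hrange this)
  ext s
  have := (hS _).1 (htop (Pi.single s 1))
  rwa [single_one_dotProduct, dvd_iff_zmod] at this

theorem unimodular_away_of_det {B : Matrix (Fin N) (Fin N) ℤ} {p : ℕ} (hp : p.Prime)
    (hpd : ¬ (p : ℤ) ∣ B.det) {x : Fin N → ℤ} (hx : ∀ y, (p : ℤ) ∣ x ⬝ᵥ B *ᵥ y) :
    ∃ z, x = (p : ℤ) • z := by
  have h : ∀ s, (p : ℤ) ∣ x s := fun s ↦ by
    have := hx (B.adjugate *ᵥ Pi.single s 1)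
    rw [mulVec_mulVec, mul_adjugate, smul_mulVec, one_mulVec, dotProduct_smul,
      dotProduct_single_one, smul_eq_mul] at this
    exact ((Nat.prime_iff_prime_int.1 hp).dvd_or_dvd this).resolve_left hpd
  choose z hz using h
  exact ⟨z, funext hz⟩

end GramMatrix

section Real

variable {N : ℕ}

theorem tendsto_floor_mul_div (a : ℝ) :
    Filter.Tendsto (fun t : ℕ ↦ (⌊t * a⌋ : ℝ) / t) Filter.atTop (nhds a) := by
  rw [tendsto_iff_dist_tendsto_zero]
  refine squeeze_zero' (Filter.Eventually.of_forall fun _ ↦ dist_nonneg) ?_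
    tendsto_one_div_atTop_nhds_zero_nat
  filter_upwards [Filter.eventually_gt_atTop 0] with t ht
  have ht' : (0 : ℝ) < t := by exact_mod_cast ht
  have e : (⌊t * a⌋ : ℝ) / t - a = -(Int.fract (t * a) / t) := by
    rw [Int.fract]
    field_simp
    ring
  rw [Real.dist_eq, e, abs_neg, abs_of_nonneg (div_nonneg (Int.fract_nonneg _) ht'.le)]
  gcongr
  exact (Int.fract_lt_one _).le

/-- A symmetric matrix close to the identity is positive definite. -/
theorem sum_pos_of_close {k : ℕ} {g : Fin k → Fin k → ℝ}
    (hg : ∀ i j, |g i j - if i = j then 1 else 0| < 1 / (k + 1)) {c : Fin k → ℝ} (hc : c ≠ 0) :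
    0 < ∑ i, ∑ j, c i * c j * g i j := by
  have hk : (0 : ℝ) < k + 1 := by positivity
  have h₁ : ∀ i j, (c i * c j * if i = j then 1 else 0) - (c i ^ 2 + c j ^ 2) / 2 * (1 / (k + 1)) ≤
      c i * c j * g i j := fun i j ↦ by
    have h := mul_le_mul (show |c i * c j| ≤ (c i ^ 2 + c j ^ 2) / 2 by
      rw [abs_mul]
      nlinarith [sq_nonneg (|c i| - |c j|), sq_abs (c i), sq_abs (c j)]) (hg i j).le (abs_nonneg _)
      (by positivity)
    rw [← abs_mul] at h
    have := neg_abs_le (c i * c j * (g i j - if i = j then 1 else 0))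
    linarith
  have hpos : 0 < ∑ i, c i ^ 2 := by
    obtain ⟨i, hi⟩ := Function.ne_iff.1 hc
    exact Finset.sum_pos' (fun i _ ↦ sq_nonneg _) ⟨i, Finset.mem_univ _, sq_pos_of_ne_zero hi⟩
  calc (0 : ℝ) < (∑ i, c i ^ 2) * (1 / (k + 1)) := by positivity
    _ = ∑ i, ∑ j, ((c i * c j * if i = j then 1 else 0) -
        (c i ^ 2 + c j ^ 2) / 2 * (1 / (k + 1))) := by
      simp only [Finset.sum_sub_distrib, mul_ite, mul_one, mul_zero, Finset.sum_ite_eq,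
        Finset.mem_univ, if_true, ← Finset.sum_mul, ← Finset.sum_div, Finset.sum_add_distrib,
        Finset.sum_const, Finset.card_univ, Fintype.card_fin, nsmul_eq_mul, ← Finset.mul_sum,
        ← pow_two]
      field_simp
      ring
    _ ≤ _ := Finset.sum_le_sum fun i _ ↦ Finset.sum_le_sum fun j _ ↦ h₁ i j

/-- A lattice whose real extension contains an orthonormal system of `k` vectors is positive on
a sublattice of rank `k`. -/
theorem posOnRank_of_orthonormal {B : Matrix (Fin N) (Fin N) ℤ} {Q : QuadraticForm ℤ (Fin N → ℤ)}
    (hQ : ∀ x y, Q.polarBilin x y = x ⬝ᵥ B *ᵥ y) {k : ℕ} (v : Fin k → Fin N → ℝ)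
    (hv : ∀ i j, v i ⬝ᵥ B.map (Int.cast : ℤ → ℝ) *ᵥ v j = if i = j then 1 else 0) :
    PosOnRank Q k := by
  have hlim : ∀ i j, Filter.Tendsto (fun t : ℕ ↦ (fun s ↦ (⌊t * v i s⌋ : ℝ) / t) ⬝ᵥ
      B.map (Int.cast : ℤ → ℝ) *ᵥ (fun s ↦ (⌊t * v j s⌋ : ℝ) / t)) Filter.atTop
      (nhds (if i = j then 1 else 0)) := fun i j ↦ by
    rw [← hv]
    refine tendsto_finsetSum _ fun a _ ↦ (tendsto_floor_mul_div _).mul ?_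
    simp only [mulVec, dotProduct]
    exact tendsto_finsetSum _ fun b _ ↦ (tendsto_floor_mul_div _).const_mul _
  have hev : ∀ᶠ t : ℕ in Filter.atTop, ∀ i j, |((fun s ↦ (⌊t * v i s⌋ : ℝ) / t) ⬝ᵥ
      B.map (Int.cast : ℤ → ℝ) *ᵥ (fun s ↦ (⌊t * v j s⌋ : ℝ) / t)) - if i = j then 1 else 0| <
      1 / (k + 1) := by
    refine Filter.eventually_all.2 fun i ↦ Filter.eventually_all.2 fun j ↦ ?_
    exact Metric.tendsto_nhds.1 (hlim i j) _ (by positivity)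
  obtain ⟨t, hclose, ht⟩ := (hev.and (Filter.eventually_gt_atTop 0)).exists
  have ht' : (0 : ℝ) < t := by exact_mod_cast ht
  refine ⟨fun i s ↦ ⌊t * v i s⌋, fun c hc ↦ ?_⟩
  have hpos := sum_pos_of_close hclose (c := fun i ↦ (c i : ℝ)) fun h ↦ hc (funext fun i ↦ by
    simpa using congr_fun h i)
  have e : ∀ i j, (fun s ↦ (⌊t * v i s⌋ : ℝ) / t) ⬝ᵥ
      B.map (Int.cast : ℤ → ℝ) *ᵥ (fun s ↦ (⌊t * v j s⌋ : ℝ) / t) =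
      (((fun s ↦ ⌊t * v i s⌋) ⬝ᵥ B *ᵥ (fun s ↦ ⌊t * v j s⌋) : ℤ) : ℝ) / t ^ 2 := fun i j ↦ by
    simp only [dotProduct, mulVec, Matrix.map_apply]
    push_cast
    rw [Finset.sum_div]
    refine Finset.sum_congr rfl fun a _ ↦ ?_
    rw [Finset.mul_sum, Finset.mul_sum, Finset.sum_div]
    refine Finset.sum_congr rfl fun b _ ↦ ?_
    field_simp
  simp only [e] at hpos
  have h2 : 2 * Q (∑ i, c i • fun s ↦ ⌊t * v i s⌋) =
      ∑ i, ∑ j, c i * c j * ((fun s ↦ ⌊t * v i s⌋) ⬝ᵥ B *ᵥ (fun s ↦ ⌊t * v j s⌋)) := by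
    rw [← polarBilin_self]
    simp only [map_sum, LinearMap.sum_apply, map_smul, LinearMap.smul_apply, hQ, smul_eq_mul,
      mul_assoc]
    simp only [Finset.mul_sum]
    rw [Finset.sum_comm]
    exact Finset.sum_congr rfl fun i _ ↦ Finset.sum_congr rfl fun j _ ↦ by ring
  have h3 : (0 : ℝ) < ((2 * Q (∑ i, c i • fun s ↦ ⌊t * v i s⌋) : ℤ) : ℝ) / t ^ 2 := by
    rw [h2]
    push_cast
    simpa only [Finset.sum_div, mul_div_assoc] using hpos
  have h4 : (0 : ℝ) < ((2 * Q (∑ i, c i • fun s ↦ ⌊t * v i s⌋) : ℤ) : ℝ) :=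
    (div_pos_iff_of_pos_right (by positivity)).1 h3
  have h5 : 0 < 2 * Q (∑ i, c i • fun s ↦ ⌊t * v i s⌋) := by exact_mod_cast h4
  exact pos_of_mul_pos_right h5 zero_le_two

/-- Concatenation of vectors, as a linear equivalence. -/
def appendLinearEquiv (R : Type*) [CommRing R] (m n : ℕ) :
    ((Fin m → R) × (Fin n → R)) ≃ₗ[R] (Fin (m + n) → R) :=
  (LinearEquiv.sumArrowLequivProdArrow (Fin m) (Fin n) R R).symm ≪≫ₗ
    LinearEquiv.funCongrLeft R R finSumFinEquiv.symm

section Append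

variable {R : Type*} [CommRing R] {m n : ℕ}

@[simp]
theorem appendLinearEquiv_castAdd (x : (Fin m → R) × (Fin n → R)) (i : Fin m) :
    appendLinearEquiv R m n x (Fin.castAdd n i) = x.1 i := by
  simp [appendLinearEquiv, LinearEquiv.funCongrLeft, LinearMap.funLeft]
  rfl

@[simp]
theorem appendLinearEquiv_natAdd (x : (Fin m → R) × (Fin n → R)) (i : Fin n) :
    appendLinearEquiv R m n x (Fin.natAdd m i) = x.2 i := by
  simp [appendLinearEquiv, LinearEquiv.funCongrLeft, LinearMap.funLeft]
  rfl

theorem dotProduct_reindex_fromBlocks_mulVec (A : Matrix (Fin m) (Fin m) R)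
    (C : Matrix (Fin n) (Fin n) R) (x y : (Fin m → R) × (Fin n → R)) :
    appendLinearEquiv R m n x ⬝ᵥ Matrix.reindex finSumFinEquiv finSumFinEquiv
      (Matrix.fromBlocks A 0 0 C) *ᵥ appendLinearEquiv R m n y =
      x.1 ⬝ᵥ A *ᵥ y.1 + x.2 ⬝ᵥ C *ᵥ y.2 := by
  simp [dotProduct, mulVec, Fin.sum_univ_add]

end Append

/-- A subspace on which a form of signature `(n, 2)` is nonpositive has dimension at most two. -/
theorem finrank_le_of_nonpos {A P : Matrix (Fin N) (Fin N) ℝ} {n m : ℕ} (hN : N = n + m)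
    (hP : Pᵀ * A * P = Matrix.diagonal fun i : Fin N ↦ if (i : ℕ) < n then (1 : ℝ) else -1)
    {V : Type*} [AddCommGroup V] [Module ℝ V] [FiniteDimensional ℝ V]
    (g : V →ₗ[ℝ] (Fin N → ℝ)) (hg : Function.Injective g) (hle : ∀ v, g v ⬝ᵥ A *ᵥ g v ≤ 0) :
    Module.finrank ℝ V ≤ m := by
  subst hN
  by_contra! hlt
  let ι : (Fin n → ℝ) →ₗ[ℝ] (Fin (n + m) → ℝ) :=
    (appendLinearEquiv ℝ n m).toLinearMap ∘ₗ LinearMap.inl ℝ (Fin n → ℝ) (Fin m → ℝ)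
  have hker := LinearMap.ker_ne_bot_of_finrank_lt (f := g.coprod (-(P.mulVecLin ∘ₗ ι))) (by
    simp only [Module.finrank_prod, Module.finrank_fin_fun]
    omega)
  obtain ⟨⟨v, c⟩, hvc, hne⟩ := (Submodule.ne_bot_iff _).1 hker
  have hv : g v = P *ᵥ ι c := by
    simpa [add_neg_eq_zero] using hvc
  have hform : (P *ᵥ ι c) ⬝ᵥ A *ᵥ (P *ᵥ ι c) = ∑ i, c i ^ 2 := by
    have : (P *ᵥ ι c) ⬝ᵥ A *ᵥ (P *ᵥ ι c) = ι c ⬝ᵥ (Pᵀ * A * P) *ᵥ ι c := by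
      simp only [← mulVec_mulVec, dotProduct_mulVec _ Pᵀ, vecMul_transpose]
    rw [this, hP, dotProduct, Fin.sum_univ_add]
    simp [mulVec_diagonal, ι, pow_two]
  have hc : c = 0 := by
    have h := hle v
    rw [hv, hform] at h
    have h0 := le_antisymm h (Finset.sum_nonneg fun i _ ↦ sq_nonneg (c i))
    rw [Finset.sum_eq_zero_iff_of_nonneg fun i _ ↦ sq_nonneg (c i)] at h0
    exact funext fun i ↦ by simpa using h0 i (Finset.mem_univ i)
  subst hc
  rw [map_zero, mulVec_zero] at hv
  exact hne (Prod.ext (hg (hv.trans (map_zero g).symm)) rfl)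

end Real

theorem exists_two_hyperbolic_planes {M : Type*} [AddCommGroup M] [Module.Free ℤ M]
    [Module.Finite ℤ M] {Q : QuadraticForm ℤ M} {d : ℤ} (hd : d ≠ 0)
    (h : IsLargeIndefinite Q d 4 3 2) :
    ∃ (e f : M) (e' f' : hyperbolicCompl Q e f)
      (T : M ≃ₗ[ℤ] (Fin 2 → ℤ) × (Fin 2 → ℤ) ×
        hyperbolicCompl (Q.comp (hyperbolicCompl Q e f).subtype) e' f'),
      ∀ x, Q x = (T x).1 0 * (T x).1 1 + ((T x).2.1 0 * (T x).2.1 1 + Q (T x).2.2) := by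
  obtain ⟨e, f, he, hf, hef⟩ := IsLargeIndefinite.exists_hyperbolic_pair (s := 1) hd h
  have h' : IsLargeIndefinite (Q.comp (hyperbolicCompl Q e f).subtype) d (0 + 2) (0 + 2) (0 + 1) :=
    IsLargeIndefinite.hyperbolicCompl he hf hef h
  obtain ⟨e', f', he', hf', hef'⟩ := h'.exists_hyperbolic_pair hd
  refine ⟨e, f, e', f', hyperbolicEquiv he hf hef ≪≫ₗ
    (LinearEquiv.refl ℤ _).prodCongr (hyperbolicEquiv he' hf' hef'), fun x ↦ ?_⟩
  rw [map_hyperbolicEquiv he hf hef]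
  congr 1
  exact map_hyperbolicEquiv he' hf' hef' (hyperbolicEquiv he hf hef x).2

theorem transpose_mul_mul_apply {R : Type*} [CommRing R] {m n : ℕ} (A : Matrix (Fin n) (Fin n) R)
    (P : Matrix (Fin n) (Fin m) R) (i j : Fin m) :
    (Pᵀ * A * P) i j = (fun s ↦ P s i) ⬝ᵥ A *ᵥ (fun s ↦ P s j) := by
  rw [Matrix.mul_assoc]
  rfl

theorem isLargeIndefinite_of_signature {N n : ℕ} {B : Matrix (Fin N) (Fin N) ℤ}
    (hB : IsEvenLatticeOfSignature B n 2) (hn : 3 ≤ n) {k : ℕ} (hk : k < n - 2)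
    (f : Fin k → ((Fin N → ℤ) ⧸ LinearMap.range (Matrix.toLin' B)))
    (hf : Submodule.span ℤ (Set.range f) = ⊤) {Q : QuadraticForm ℤ (Fin N → ℤ)}
    (hQ : ∀ x y, Q.polarBilin x y = x ⬝ᵥ B *ᵥ y) : IsLargeIndefinite Q B.det 4 3 2 := by
  obtain ⟨rfl, hsymm, -, hdet, P, -, hP⟩ := hB
  have hcol : ∀ i j, (fun s ↦ P s i) ⬝ᵥ B.map (Int.cast : ℤ → ℝ) *ᵥ (fun s ↦ P s j) =
      if i = j then if (i : ℕ) < n then (1 : ℝ) else -1 else 0 := fun i j ↦ by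
    rw [← transpose_mul_mul_apply, hP, diagonal_apply]
  refine ⟨fun x hx ↦ ?_, fun p hp hpd x hx ↦ ?_, rankGT_of_span hQ (by omega) f hf, ?_, ?_⟩
  · refine eq_zero_of_vecMul_eq_zero hdet (funext fun i ↦ ?_)
    have := hx (Pi.single i 1)
    rwa [hQ, dotProduct_mulVec, dotProduct_single_one] at this
  · exact unimodular_away_of_det hp hpd fun y ↦ by simpa only [hQ] using hx y
  · refine posOnRank_of_orthonormal hQ (fun i s ↦ P s (Fin.castLE (by omega) i)) fun i j ↦ ?_
    rw [hcol]
    have : (i : ℕ) < n := by omega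
    simp [this]
  · refine posOnRank_of_orthonormal (B := -B) (fun x y ↦ ?_) (fun i s ↦ P s (Fin.natAdd n i))
      fun i j ↦ ?_
    · rw [neg_mulVec, dotProduct_neg, ← hQ]
      simp [QuadraticMap.polarBilin, QuadraticMap.polar_neg]
    · have : (-B).map (Int.cast : ℤ → ℝ) = -B.map (Int.cast : ℤ → ℝ) := by
        ext
        simp
      rw [this, neg_mulVec, dotProduct_neg, hcol]
      split_ifs with h₁ h₂ <;> simp_all

theorem dotProduct_U_mulVec (x y : Fin 2 → ℤ) : x ⬝ᵥ U *ᵥ y = x 0 * y 1 + x 1 * y 0 := by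
  simp [U, dotProduct, mulVec, Fin.sum_univ_two]

theorem dsum_map_intCast {m n : ℕ} (A : Matrix (Fin m) (Fin m) ℤ) (C : Matrix (Fin n) (Fin n) ℤ) :
    (dsum A C).map (Int.cast : ℤ → ℝ) = Matrix.reindex finSumFinEquiv finSumFinEquiv
      (Matrix.fromBlocks (A.map (Int.cast : ℤ → ℝ)) 0 0 (C.map (Int.cast : ℤ → ℝ))) := by
  rw [dsum, reindex_apply, reindex_apply, ← submatrix_map, fromBlocks_map,
    Matrix.map_zero _ Int.cast_zero, Matrix.map_zero _ Int.cast_zero]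

/-- A complement of two hyperbolic planes in a lattice of signature `(n, 2)` is positive
definite. -/
theorem posDef_of_latIso {N n r : ℕ} {B : Matrix (Fin N) (Fin N) ℤ}
    (hB : IsEvenLatticeOfSignature B n 2) {L : Matrix (Fin r) (Fin r) ℤ} (hL : L.IsSymm)
    (h : LatIso B (dsum U (dsum U L))) : (L.map (Int.cast : ℤ → ℝ)).PosDef := by
  obtain ⟨hN, -, -, -, P, -, hP⟩ := hB
  obtain ⟨e, he⟩ := h
  refine .of_dotProduct_mulVec_pos ?_ fun x hx ↦ ?_
  · rw [IsHermitian, conjTranspose_eq_transpose_of_trivial, ← transpose_map, hL.eq]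
  by_contra! hle
  rw [star_trivial] at hle
  set E := LinearMap.toMatrix' e.symm.toLinearMap
  have hE : ∀ a, E *ᵥ a = e.symm a := fun a ↦ by
    rw [← toLin'_apply, toLin'_toMatrix']
    rfl
  have hinv : LinearMap.toMatrix' e.toLinearMap * E = 1 := by
    rw [← LinearMap.toMatrix'_comp, ← LinearMap.toMatrix'_id]
    congr 1
    exact LinearMap.ext e.apply_symm_apply
  have hform : Eᵀ * B * E = dsum U (dsum U L) := by
    ext i j
    have := he (e.symm (Pi.single i 1)) (e.symm (Pi.single j 1))
    rw [e.apply_symm_apply, e.apply_symm_apply, single_one_dotProduct, mulVec_single_one] at this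
    rw [transpose_mul_mul_apply]
    change _ = (dsum U (dsum U L)).col j i
    rw [this, ← hE, ← hE, mulVec_single_one, mulVec_single_one]
    rfl
  set E' := E.map (Int.cast : ℤ → ℝ)
  have hinj : Function.Injective fun a ↦ E' *ᵥ a := by
    refine Function.LeftInverse.injective
      (g := fun a ↦ (LinearMap.toMatrix' e.toLinearMap).map (Int.cast : ℤ → ℝ) *ᵥ a) fun a ↦ ?_
    have := congr_arg (fun A ↦ A.map (Int.castRingHom ℝ)) hinv
    simp only [Matrix.map_mul, Matrix.map_one _ (map_zero (Int.castRingHom ℝ)) (map_one _)] at this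
    change _ *ᵥ (_ *ᵥ _) = _
    rw [mulVec_mulVec]
    exact (congr_arg (· *ᵥ a) this).trans (one_mulVec a)
  have hform' : E'ᵀ * B.map (Int.cast : ℤ → ℝ) * E' = Matrix.reindex finSumFinEquiv finSumFinEquiv
      (Matrix.fromBlocks (U.map (Int.cast : ℤ → ℝ)) 0 0
        (Matrix.reindex finSumFinEquiv finSumFinEquiv
          (Matrix.fromBlocks (U.map (Int.cast : ℤ → ℝ)) 0 0 (L.map (Int.cast : ℤ → ℝ))))) := by
    have := congr_arg (fun A ↦ A.map (Int.castRingHom ℝ)) hform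
    simp only [Matrix.map_mul] at this
    rw [← dsum_map_intCast, ← dsum_map_intCast]
    exact this
  let w : (Fin 3 → ℝ) →ₗ[ℝ] (Fin (2 + (2 + r)) → ℝ) := (appendLinearEquiv ℝ _ _).toLinearMap ∘ₗ
    ((LinearMap.proj (R := ℝ) (φ := fun _ ↦ ℝ) (0 : Fin 3)).smulRight ![1, -1]).prod
      ((appendLinearEquiv ℝ _ _).toLinearMap ∘ₗ
        ((LinearMap.proj (R := ℝ) (φ := fun _ ↦ ℝ) (1 : Fin 3)).smulRight ![1, -1]).prod
          ((LinearMap.proj (R := ℝ) (φ := fun _ ↦ ℝ) (2 : Fin 3)).smulRight x))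
  have hw : ∀ s, w s = appendLinearEquiv ℝ _ _ (s 0 • ![1, -1], appendLinearEquiv ℝ _ _
      (s 1 • ![1, -1], s 2 • x)) := fun s ↦ rfl
  have hwinj : Function.Injective w := by
    rw [injective_iff_map_eq_zero]
    intro s hs
    rw [hw, LinearEquiv.map_eq_zero_iff, Prod.mk_eq_zero, LinearEquiv.map_eq_zero_iff,
      Prod.mk_eq_zero] at hs
    have h2 := (smul_eq_zero.1 hs.2.2).resolve_right hx
    have h0 : s 0 = 0 := by simpa using congr_fun hs.1 0
    have h1 : s 1 = 0 := by simpa using congr_fun hs.2.1 0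
    ext i
    fin_cases i
    exacts [h0, h1, h2]
  have h3 := finrank_le_of_nonpos hN hP (E'.mulVecLin ∘ₗ w) (hinj.comp hwinj) fun s ↦ by
    have e₁ : ((E'.mulVecLin ∘ₗ w) s) ⬝ᵥ B.map (Int.cast : ℤ → ℝ) *ᵥ ((E'.mulVecLin ∘ₗ w) s) =
        w s ⬝ᵥ (E'ᵀ * B.map (Int.cast : ℤ → ℝ) * E') *ᵥ w s := by
      simp only [← mulVec_mulVec, dotProduct_mulVec _ E'ᵀ, vecMul_transpose]
      rfl
    have hU : (![1, -1] : Fin 2 → ℝ) ⬝ᵥ U.map (Int.cast : ℤ → ℝ) *ᵥ ![1, -1] = -2 := by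
      simp [U, dotProduct, mulVec, Fin.sum_univ_two]
      norm_num
    rw [e₁, hform', hw, dotProduct_reindex_fromBlocks_mulVec, dotProduct_reindex_fromBlocks_mulVec]
    simp only [mulVec_smul, smul_dotProduct, dotProduct_smul, hU, smul_eq_mul]
    nlinarith [mul_nonneg (mul_self_nonneg (s 2)) (neg_nonneg.2 hle), mul_self_nonneg (s 0),
      mul_self_nonneg (s 1)]
  simp at h3

/-- If M is an even lattice of signature (n,2) with n ≥ 3 and the
discriminant group of M needs fewer than n − 2 generators, then M ≅ U ⊕ U ⊕ L with L
even positive-definite of rank n − 2. -/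
theorem split_two_hyperbolic_planes {N n : ℕ} (B : Matrix (Fin N) (Fin N) ℤ)
    (hB : IsEvenLatticeOfSignature B n 2) (hn : 3 ≤ n)
    (hgen : ∃ k : ℕ, k < n - 2 ∧
      ∃ f : Fin k → ((Fin N → ℤ) ⧸ LinearMap.range (Matrix.toLin' B)),
        Submodule.span ℤ (Set.range f) = ⊤) :
    ∃ L : Matrix (Fin (n - 2)) (Fin (n - 2)) ℤ, IsEvenPosDef L ∧
      LatIso B (dsum U (dsum U L)) := by
  obtain ⟨k, hk, f, hf⟩ := hgen
  obtain ⟨Q, hQ⟩ := exists_quadraticForm hB.2.1 hB.2.2.1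
  obtain ⟨e, f, e', f', T, hT⟩ := exists_two_hyperbolic_planes hB.2.2.2.1
    (isLargeIndefinite_of_signature hB hn hk f hf hQ)
  generalize hK : hyperbolicCompl (Q.comp (hyperbolicCompl Q e f).subtype) e' f' = K at T hT
  let Q' : QuadraticForm ℤ K := (Q.comp (hyperbolicCompl Q e f).subtype).comp K.subtype
  have hrank : Module.finrank ℤ K = n - 2 := by
    have h₁ := T.finrank_eq
    have h₂ := hB.1
    simp only [Module.finrank_prod, Module.finrank_fin_fun] at h₁
    omega
  let b := Module.finBasisOfFinrankEq ℤ K hrank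
  let L := LinearMap.toMatrix₂ b b Q'.polarBilin
  have hLform : ∀ x y : K, b.equivFun x ⬝ᵥ L *ᵥ b.equivFun y = Q'.polarBilin x y := fun x y ↦
    (apply_eq_dotProduct_toMatrix₂_mulVec b b Q'.polarBilin x y).symm
  have hLsymm : L.IsSymm := by
    ext i j
    simp only [L, transpose_apply, LinearMap.toMatrix₂_apply]
    exact polarBilin_comm _ _ _
  have hiso : LatIso B (dsum U (dsum U L)) := by
    refine ⟨T ≪≫ₗ ((LinearEquiv.refl ℤ (Fin 2 → ℤ)).prodCongr
      ((LinearEquiv.refl ℤ (Fin 2 → ℤ)).prodCongr b.equivFun ≪≫ₗ appendLinearEquiv ℤ _ _)) ≪≫ₗ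
      appendLinearEquiv ℤ _ _, fun x y ↦ ?_⟩
    change appendLinearEquiv ℤ 2 (2 + (n - 2)) ((T x).1, appendLinearEquiv ℤ 2 (n - 2)
        ((T x).2.1, b.equivFun (T x).2.2)) ⬝ᵥ dsum U (dsum U L) *ᵥ
      appendLinearEquiv ℤ 2 (2 + (n - 2)) ((T y).1, appendLinearEquiv ℤ 2 (n - 2)
        ((T y).2.1, b.equivFun (T y).2.2)) = _
    rw [dsum, dotProduct_reindex_fromBlocks_mulVec, dsum, dotProduct_reindex_fromBlocks_mulVec,
      dotProduct_U_mulVec, dotProduct_U_mulVec, hLform, ← hQ]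
    have h₁ : Q.polarBilin x y = Q (x + y) - Q x - Q y := rfl
    have h₂ : Q'.polarBilin (T x).2.2 (T y).2.2 =
      Q ((T x).2.2 + (T y).2.2 : K) - Q (T x).2.2 - Q (T y).2.2 := rfl
    rw [h₁, h₂, hT (x + y), hT x, hT y]
    simp only [map_add, Prod.fst_add, Prod.snd_add, Pi.add_apply]
    ring
  refine ⟨L, ⟨hLsymm, fun x ↦ ?_, posDef_of_latIso hB hLsymm hiso⟩, hiso⟩
  have := hLform (b.equivFun.symm x) (b.equivFun.symm x)
  rw [b.equivFun.apply_symm_apply, polarBilin_self] at this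
  exact ⟨_, this⟩

end Refl
end

section
/- Let L be an even positive-definite lattice, n(L) the positive generator of the ideal of ℤ generated by {(x,y) : x,y ∈ L}, and σ_1(m) = Σ_{d|m} d. Let f_0 : L^∨ → ℤ be a finitely supported function with f_0(ℓ) = f_0(−ℓ) for all ℓ, and let g : {n ∈ ℤ : n < 0} × L^∨ → ℤ be a finitely supported function. Set C = (1/24)·Σ_{ℓ∈L^∨} f_0(ℓ) − Σ_{n<0} Σ_{ℓ∈L^∨} g(n,ℓ)·σ_1(−n), and assume that Σ_{ℓ∈L^∨} f_0(ℓ)·(ℓ,z)² = 2C·(z,z) for all z ∈ L ⊗ ℝ. Then (n(L)/24)·Σ_{ℓ∈L^∨} f_0(ℓ) ∈ ℤ. (These hypotheses are satisfied by the q^0-term coefficients f_0(ℓ) = f(0,ℓ) and the principal-part coefficients g(n,ℓ) = f(n,ℓ) of any weakly holomorphic Jacobi form of weight 0 and index L whose Fourier coefficients f(n,ℓ) are integral for n ≤ 0.) -/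
open Matrix

namespace Refl

theorem rpair_add_right {n : ℕ} (B : Matrix (Fin n) (Fin n) ℤ) (x y z : Fin n → ℝ) :
    rpair B x (y + z) = rpair B x y + rpair B x z := by
  simp only [rpair, Pi.add_apply, mul_add, Finset.sum_add_distrib]

theorem rpair_add_left {n : ℕ} (B : Matrix (Fin n) (Fin n) ℤ) (x y z : Fin n → ℝ) :
    rpair B (x + y) z = rpair B x z + rpair B y z := by
  simp only [rpair, Pi.add_apply, mul_add, add_mul, Finset.sum_add_distrib]

theorem rpair_comm {n : ℕ} {B : Matrix (Fin n) (Fin n) ℤ} (hB : B.IsSymm) (x y : Fin n → ℝ) :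
    rpair B x y = rpair B y x := by
  unfold rpair
  rw [Finset.sum_comm]
  refine Finset.sum_congr rfl fun i _ => Finset.sum_congr rfl fun j _ => ?_
  rw [hB.apply i j]
  ring

theorem rpair_ratR_intR {n : ℕ} (B : Matrix (Fin n) (Fin n) ℤ) (x : Fin n → ℚ)
    (y : Fin n → ℤ) : rpair B (ratR x) (intR y) = (qpair B x (intQ y) : ℝ) := by
  simp [rpair, qpair, ratR, intR, intQ]

theorem rpair_intR_intR {n : ℕ} (B : Matrix (Fin n) (Fin n) ℤ) (x y : Fin n → ℤ) :
    rpair B (intR x) (intR y) = ((x ⬝ᵥ B.mulVec y : ℤ) : ℝ) := by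
  simp only [rpair, intR, dotProduct, mulVec, Int.cast_sum, Int.cast_mul, Finset.mul_sum]
  refine Finset.sum_congr rfl fun i _ => Finset.sum_congr rfl fun j _ => ?_
  ring

theorem qpair_neg_left {n : ℕ} (B : Matrix (Fin n) (Fin n) ℤ) (x y : Fin n → ℚ) :
    qpair B (-x) y = -qpair B x y := by
  simp [qpair]

theorem qpair_zero_left {n : ℕ} (B : Matrix (Fin n) (Fin n) ℤ) (y : Fin n → ℚ) :
    qpair B 0 y = 0 := by
  simp [qpair]

/-- A sum of an even integer-valued function over a symmetric finite set is even if the function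
vanishes at the origin. -/
theorem two_dvd_sum_of_even {M : Type*} [AddCommGroup M] [IsAddTorsionFree M] (s : Finset M)
    (hs : ∀ x ∈ s, -x ∈ s) (h : M → ℤ) (h_zero : h 0 = 0) (h_neg : ∀ x ∈ s, h (-x) = h x) :
    2 ∣ ∑ x ∈ s, h x := by
  have key : ((∑ x ∈ s, h x : ℤ) : ZMod 2) = 0 := by
    rw [Int.cast_sum]
    refine Finset.sum_involution (fun x _ => -x) ?_ ?_ (fun x hx => hs x hx) ?_
    · intro x hx
      rw [h_neg x hx]
      exact CharTwo.add_self_eq_zero _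
    · intro x _ hx h_eq
      apply hx
      rw [self_eq_neg.mp h_eq.symm, h_zero, Int.cast_zero]
    · intro x _
      exact neg_neg x
  exact_mod_cast (ZMod.intCast_zmod_eq_zero_iff_dvd _ 2).mp key

/-- If `∑ f(ℓ) (ℓ,z)² = 2C (z,z)` for an even, finitely supported, integer-valued function `f` on
the dual lattice, then `C (x,y)` is an integer for all lattice vectors `x`, `y`. -/
theorem exists_int_eq_mul_pairing {n : ℕ} {B : Matrix (Fin n) (Fin n) ℤ} (hB : B.IsSymm)
    (f : (Fin n → ℚ) → ℤ) (h_fin : {x | f x ≠ 0}.Finite)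
    (h_dual : ∀ x, f x ≠ 0 → InDual B x) (h_even : ∀ x, f (-x) = f x) (C : ℚ)
    (h_vec : ∀ z : Fin n → ℝ,
      (∑ᶠ x, (f x : ℝ) * (rpair B (ratR x) z) ^ 2) = 2 * (C : ℝ) * rpair B z z)
    (x y : Fin n → ℤ) : ∃ m : ℤ, C * ((x ⬝ᵥ B.mulVec y : ℤ) : ℚ) = m := by
  set s := h_fin.toFinset with hs
  have mem_s : ∀ l, l ∈ s ↔ f l ≠ 0 := fun l => by simp [hs]
  have h_sum : ∀ z : Fin n → ℝ,
      ∑ l ∈ s, (f l : ℝ) * (rpair B (ratR l) z) ^ 2 = 2 * (C : ℝ) * rpair B z z := by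
    intro z
    rw [← h_vec z, finsum_eq_sum_of_support_subset]
    intro l hl
    simp only [Function.mem_support] at hl
    exact (mem_s l).mpr fun h => hl (by simp [h])
  have polar : ∑ l ∈ s, (f l : ℝ) * (rpair B (ratR l) (intR x) * rpair B (ratR l) (intR y)) =
      2 * (C : ℝ) * rpair B (intR x) (intR y) := by
    have hxy := h_sum (intR x + intR y)
    have expand : ∀ l, (f l : ℝ) * (rpair B (ratR l) (intR x + intR y)) ^ 2 =
        (f l : ℝ) * (rpair B (ratR l) (intR x)) ^ 2 +
        (f l : ℝ) * (rpair B (ratR l) (intR y)) ^ 2 +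
        2 * ((f l : ℝ) * (rpair B (ratR l) (intR x) * rpair B (ratR l) (intR y))) := by
      intro l
      rw [rpair_add_right]
      ring
    simp only [expand, Finset.sum_add_distrib, ← Finset.mul_sum, h_sum] at hxy
    simp only [rpair_add_right, rpair_add_left,
      rpair_comm hB (intR y) (intR x)] at hxy
    linarith
  let h : (Fin n → ℚ) → ℤ := fun l => f l * ⌊qpair B l (intQ x) * qpair B l (intQ y)⌋
  have h_two : 2 ∣ ∑ l ∈ s, h l := by
    refine two_dvd_sum_of_even s (fun l hl => ?_) h ?_ fun l _ => ?_
    · rw [mem_s] at hl ⊢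
      rwa [h_even]
    · simp [h, qpair_zero_left]
    · simp [h, qpair_neg_left, h_even]
  obtain ⟨m, hm⟩ := h_two
  refine ⟨m, ?_⟩
  have h_cast : ((∑ l ∈ s, h l : ℤ) : ℝ) = 2 * (C : ℝ) * rpair B (intR x) (intR y) := by
    rw [← polar, Int.cast_sum]
    refine Finset.sum_congr rfl fun l hl => ?_
    obtain ⟨a, ha⟩ := h_dual l ((mem_s l).mp hl) x
    obtain ⟨b, hb⟩ := h_dual l ((mem_s l).mp hl) y
    simp only [h, rpair_ratR_intR, ha, hb]
    rw [← Int.cast_mul a b, Int.floor_intCast]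
    push_cast
    ring
  rw [hm, rpair_intR_intR] at h_cast
  have h_real : (C : ℝ) * ((x ⬝ᵥ B.mulVec y : ℤ) : ℝ) = m := by
    push_cast at h_cast ⊢
    linarith
  exact_mod_cast h_real

/-- Integrality of (n(L)/24)·Σ f₀(ℓ) for the q⁰-term of a weight-0 weakly
holomorphic Jacobi form. -/
theorem weight_zero_integrality {r : ℕ} (B : Matrix (Fin r) (Fin r) ℤ)
    (hB : IsEvenPosDef B) (nL : ℤ) (hnL : 0 < nL)
    (hgen : Ideal.span {a : ℤ | ∃ x y : Fin r → ℤ, a = x ⬝ᵥ B.mulVec y} =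
      Ideal.span {nL})
    (f₀ : (Fin r → ℚ) → ℤ) (hf₀fin : {x | f₀ x ≠ 0}.Finite)
    (hf₀dual : ∀ x, f₀ x ≠ 0 → InDual B x)
    (hf₀even : ∀ x, f₀ (-x) = f₀ x)
    (g : ℤ × (Fin r → ℚ) → ℤ) (hgfin : {p | g p ≠ 0}.Finite)
    (hgsupp : ∀ p, g p ≠ 0 → p.1 < 0 ∧ InDual B p.2)
    (C : ℚ)
    (hC : C = (1 / 24) * (∑ᶠ x, (f₀ x : ℚ)) -
      ∑ᶠ p : ℤ × (Fin r → ℚ), (g p : ℚ) * (sigma1 (-p.1) : ℚ))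
    (hvec : ∀ z : Fin r → ℝ,
      (∑ᶠ x, (f₀ x : ℝ) * (rpair B (ratR x) z) ^ 2) = 2 * (C : ℝ) * rpair B z z) :
    ∃ m : ℤ, (nL : ℚ) / 24 * (∑ᶠ x, (f₀ x : ℚ)) = (m : ℚ) := by
  have h_ideal : ∀ a ∈ Ideal.span {a : ℤ | ∃ x y : Fin r → ℤ, a = x ⬝ᵥ B.mulVec y},
      ∃ m : ℤ, C * (a : ℚ) = m := by
    intro a ha
    induction ha using Submodule.span_induction with
    | mem a ha =>
      obtain ⟨x, y, rfl⟩ := ha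
      exact exists_int_eq_mul_pairing hB.1 f₀ hf₀fin hf₀dual hf₀even C hvec x y
    | zero => exact ⟨0, by simp⟩
    | add a b _ _ iha ihb =>
      obtain ⟨m, hm⟩ := iha
      obtain ⟨k, hk⟩ := ihb
      exact ⟨m + k, by push_cast; rw [mul_add, hm, hk]⟩
    | smul c a _ iha =>
      obtain ⟨m, hm⟩ := iha
      exact ⟨c * m, by push_cast [smul_eq_mul]; rw [← hm]; ring⟩
  obtain ⟨m, hm⟩ := h_ideal nL (hgen ▸ Ideal.mem_span_singleton_self nL)
  have h_int : ∑ᶠ p : ℤ × (Fin r → ℚ), (g p : ℚ) * (sigma1 (-p.1) : ℚ) =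
      ((∑ p ∈ hgfin.toFinset, g p * sigma1 (-p.1) : ℤ) : ℚ) := by
    rw [finsum_eq_sum_of_support_subset (s := hgfin.toFinset)]
    · push_cast
      rfl
    · intro p hp
      simp only [Function.mem_support] at hp
      simp only [Set.Finite.coe_toFinset, Set.mem_ofPred_eq]
      exact fun h => hp (by simp [h])
  rw [h_int] at hC
  refine ⟨m + nL * ∑ p ∈ hgfin.toFinset, g p * sigma1 (-p.1), ?_⟩
  rw [Int.cast_add, Int.cast_mul, ← hm, hC]
  ring

end Refl
end
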